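/- arXiv:1811.00015 — 2 statements merged into one kernel-verified Lean document; each statement's English description precedes it below -/
import Mathlib

section
/- If the volume of a [t]-trade is less than 2^{t+1} + 2^{t−1}, then the volume has one of the following forms: (1) 2^{t+1} − 2^i with i ∈ {0,…,t+1}; (2) 2^{t+1} + 2^i with i ∈ {⌈(t−1)/2⌉,…,t−2}; (3) 2^{t+1} + 2^{t−1} − 2^i with i ∈ {0,…,t−1}; (4) 2^{t+1} + 2^{t−1} − 3·2^i with i ∈ {0,…,t−3}. -/
/-- The size (number of ones) of a vector of `F_2^v`. -/
def size {v : ℕ} (x : Fin v → ZMod 2) : ℕ :=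
  (Finset.univ.filter (fun j => x j = 1)).card

/-- A `[t]`-trade. -/
def IsTrade (t v : ℕ) (T0 T1 : Finset (Fin v → ZMod 2)) : Prop :=
  Disjoint T0 T1 ∧
  ∀ s : Fin v → ZMod 2, size s ≤ t →
    (T0.filter (fun x => ∀ j, s j = 1 → x j = 1)).card =
    (T1.filter (fun x => ∀ j, s j = 1 → x j = 1)).card


namespace TT

open Finset

abbrev G (v : ℕ) := Fin v → ZMod 2

def sg (a : ZMod 2) : ℤ := if a = 0 then 1 else -1

lemma sg_add : ∀ a b : ZMod 2, sg (a + b) = sg a * sg b := by decide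
lemma sg_cases : ∀ a : ZMod 2, sg a = 1 ∨ sg a = -1 := by decide
lemma sg_zero : sg 0 = 1 := by decide

variable {v : ℕ}

def chi (u x : G v) : ℤ := sg (u ⬝ᵥ x)

lemma chi_comm (u x : G v) : chi u x = chi x u := by
  unfold chi; rw [dotProduct_comm]
lemma chi_add (u w x : G v) : chi (u + w) x = chi u x * chi w x := by
  unfold chi; rw [add_dotProduct, sg_add]
lemma chi_add' (u x y : G v) : chi u (x + y) = chi u x * chi u y := by
  unfold chi; rw [dotProduct_add, sg_add]
lemma chi_zero (x : G v) : chi 0 x = 1 := by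
  unfold chi; rw [zero_dotProduct, sg_zero]
lemma chi_zero' (x : G v) : chi x 0 = 1 := by
  unfold chi; rw [dotProduct_zero, sg_zero]
lemma chi_cases (u x : G v) : chi u x = 1 ∨ chi u x = -1 := sg_cases _
lemma chi_sq (u x : G v) : chi u x * chi u x = 1 := by
  rcases chi_cases u x with h | h <;> rw [h] <;> norm_num
lemma chi_abs (u x : G v) : |chi u x| = 1 := by
  rcases chi_cases u x with h | h <;> rw [h] <;> norm_num

lemma g_add_self (u : G v) : u + u = 0 := by
  funext j; exact CharTwo.add_self_eq_zero _
lemma g_add_add (u w : G v) : u + w + w = u := by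
  rw [add_assoc, g_add_self, add_zero]
lemma g_eq_of_add (u w : G v) (h : u + w = 0) : u = w := by
  rw [← g_add_add u w, h, zero_add]

lemma card_G : ((univ : Finset (G v)).card : ℤ) = 2 ^ v := by
  simp [Finset.card_univ, ZMod.card]

lemma sum_shift (w : G v) (g : G v → ℤ) : ∑ u, g (u + w) = ∑ u, g u :=
  Equiv.sum_comp (Equiv.addRight w) g

lemma exists_chi (x : G v) (hx : x ≠ 0) : ∃ w : G v, chi w x = -1 := by
  have : ∃ j, x j ≠ 0 := by
    by_contra h; push Not at h; exact hx (funext h)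
  obtain ⟨j, hj⟩ := this
  refine ⟨Pi.single j 1, ?_⟩
  unfold chi
  rw [single_dotProduct, one_mul]
  unfold sg; rw [if_neg hj]

lemma sum_chi (x : G v) : ∑ u : G v, chi u x = if x = 0 then 2 ^ v else 0 := by
  split_ifs with h
  · subst h; simp only [chi_zero']; rw [← card_G]; simp
  · obtain ⟨w, hw⟩ := exists_chi x h
    have h1 := sum_shift w (fun u => chi u x)
    simp only [chi_add, hw] at h1
    rw [← sum_mul] at h1
    linarith

def F (f : G v → ℤ) (u : G v) : ℤ := ∑ x, f x * chi u x
def N (f : G v → ℤ) : ℤ := ∑ x, |f x|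
def M (k : ℕ) (f : G v → ℤ) : Prop := ∀ u, (2 ^ k : ℤ) ∣ F f u
def Pl (f : G v → ℤ) : Prop := ∀ x, f x = 0 ∨ f x = 1 ∨ f x = -1
def De (f : G v → ℤ) (h : G v) : ℤ := ∑ x, |f x| * chi h x
def R (f : G v → ℤ) (h : G v) : ℤ := ∑ u, |F f u * F f (u + h)|
def hf (s : ℤ) (h : G v) (f : G v → ℤ) (x : G v) : ℤ := if chi h x = s then f x else 0

def Sg (s : ℤ) : Prop := s = 1 ∨ s = -1

lemma two_hf {s : ℤ} (hs : Sg s) (h : G v) (f : G v → ℤ) (x : G v) :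
    2 * hf s h f x = f x * (1 + s * chi h x) := by
  unfold hf
  rcases hs with rfl | rfl <;> rcases chi_cases h x with h1 | h1 <;> rw [h1] <;> norm_num <;> ring

lemma two_abs_hf {s : ℤ} (hs : Sg s) (h : G v) (f : G v → ℤ) (x : G v) :
    2 * |hf s h f x| = |f x| * (1 + s * chi h x) := by
  unfold hf
  rcases hs with rfl | rfl <;> rcases chi_cases h x with h1 | h1 <;> rw [h1] <;> norm_num <;> ring

lemma F_hf {s : ℤ} (hs : Sg s) (h : G v) (f : G v → ℤ) (u : G v) :
    2 * F (hf s h f) u = F f u + s * F f (u + h) := by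
  unfold F
  rw [mul_sum, mul_sum, ← sum_add_distrib]
  refine sum_congr rfl fun x _ => ?_
  rw [← mul_assoc, two_hf hs, chi_add]; ring

lemma N_hf {s : ℤ} (hs : Sg s) (h : G v) (f : G v → ℤ) :
    2 * N (hf s h f) = N f + s * De f h := by
  unfold N De
  rw [mul_sum, mul_sum, ← sum_add_distrib]
  refine sum_congr rfl fun x _ => ?_
  rw [two_abs_hf hs]; ring

lemma Pl_hf {s : ℤ} (h : G v) {f : G v → ℤ} (hp : Pl f) : Pl (hf s h f) := by
  intro x; unfold hf; split_ifs
  · exact hp x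
  · left; rfl

lemma M_hf {s : ℤ} (hs : Sg s) (h : G v) {f : G v → ℤ} {k : ℕ} (hm : M (k + 1) f) :
    M k (hf s h f) := by
  intro u
  obtain ⟨a, ha⟩ := hm u
  obtain ⟨b, hb⟩ := hm (u + h)
  have := F_hf hs h f u
  rw [ha, hb, pow_succ] at this
  exact ⟨a + s * b, by linarith⟩

lemma N_nonneg (f : G v → ℤ) : 0 ≤ N f := sum_nonneg fun _ _ => abs_nonneg _

lemma F_le (f : G v → ℤ) (u : G v) : |F f u| ≤ N f := by
  unfold F N
  refine (abs_sum_le_sum_abs _ _).trans (le_of_eq ?_)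
  refine sum_congr rfl fun x _ => ?_
  rw [abs_mul, chi_abs, mul_one]

lemma De_le (f : G v → ℤ) (u : G v) : |De f u| ≤ N f := by
  unfold De N
  refine (abs_sum_le_sum_abs _ _).trans (le_of_eq ?_)
  refine sum_congr rfl fun x _ => ?_
  rw [abs_mul, chi_abs, mul_one, abs_abs]

lemma De_zero (f : G v → ℤ) : De f 0 = N f := by
  unfold De N; simp only [chi_zero, mul_one]

lemma sum_chi_mul (x y : G v) : ∑ u : G v, chi u x * chi u y = if x = y then 2 ^ v else 0 := by
  simp only [← chi_add']
  rw [sum_chi]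
  refine if_congr ⟨g_eq_of_add x y, fun h => by rw [h, g_add_self]⟩ rfl rfl

lemma F_inv (f : G v → ℤ) (x : G v) : ∑ u, F f u * chi u x = 2 ^ v * f x := by
  unfold F
  simp only [sum_mul]
  rw [sum_comm]
  simp only [mul_assoc, ← mul_sum, sum_chi_mul]
  simp [mul_comm]

lemma N_eq_zero {f : G v → ℤ} (h : N f = 0) (x : G v) : f x = 0 := by
  unfold N at h
  rw [sum_eq_zero_iff_of_nonneg (fun _ _ => abs_nonneg _)] at h
  exact abs_eq_zero.1 (h x (mem_univ _))

lemma eq_zero_of_F {f : G v → ℤ} (h : ∀ u, F f u = 0) (x : G v) : f x = 0 := by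
  have := F_inv f x
  simp only [h, zero_mul, sum_const_zero] at this
  have h2 : (2:ℤ) ^ v ≠ 0 := by positivity
  exact (mul_eq_zero.1 this.symm).resolve_left h2

lemma N_of_zero {f : G v → ℤ} (h : ∀ x, f x = 0) : N f = 0 := by
  unfold N; simp [h]

lemma zero_of_small {f : G v → ℤ} {k : ℕ} (hm : M k f) (hN : N f < 2 ^ k) : N f = 0 := by
  apply N_of_zero
  apply eq_zero_of_F
  intro u
  exact Int.eq_zero_of_abs_lt_dvd (hm u) (lt_of_le_of_lt (F_le f u) hN)

lemma N_ge {f : G v → ℤ} {k : ℕ} (hm : M k f) (hN : 0 < N f) : 2 ^ k ≤ N f := by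
  by_contra h
  have := zero_of_small hm (not_le.1 h)
  omega

lemma N_even {f : G v → ℤ} {k : ℕ} (hm : M (k + 1) f) : 2 ∣ N f := by
  have h1 : (2 : ℤ) ∣ F f 0 := (Dvd.intro_left _ (pow_succ 2 k).symm).trans (hm 0)
  have h2 : F f 0 = ∑ x, f x := by unfold F; simp only [chi_zero, mul_one]
  have h3 : (2 : ℤ) ∣ N f - F f 0 := by
    rw [h2]; unfold N; rw [← sum_sub_distrib]
    refine dvd_sum fun x _ => ?_
    rcases abs_cases (f x) with h | h <;> omega
  omega

lemma parseval (f : G v → ℤ) (h : G v) :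
    ∑ u, F f u * F f (u + h) = 2 ^ v * ∑ x, f x * f x * chi h x := by
  have h1 : ∀ u, F f u * F f (u + h) = ∑ x, f x * chi h x * (F f u * chi u x) := by
    intro u
    conv_lhs => rw [show F f (u + h) = ∑ x, f x * chi (u + h) x from rfl]
    rw [mul_sum]
    refine sum_congr rfl fun x _ => ?_
    rw [chi_add]; ring
  simp only [h1]
  rw [sum_comm]
  simp only [← mul_sum, F_inv]
  rw [mul_sum]
  refine sum_congr rfl fun x _ => ?_
  ring

lemma parseval_De {f : G v → ℤ} (hp : Pl f) (h : G v) :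
    ∑ u, F f u * F f (u + h) = 2 ^ v * De f h := by
  rw [parseval]; unfold De
  congr 1
  refine sum_congr rfl fun x _ => ?_
  rcases hp x with h | h | h <;> rw [h] <;> norm_num

lemma sum_F_sq {f : G v → ℤ} (hp : Pl f) : ∑ u, F f u * F f u = 2 ^ v * N f := by
  have := parseval_De hp 0
  simpa only [add_zero, De_zero] using this

lemma sum_De_sq {f : G v → ℤ} (hp : Pl f) : ∑ h, De f h * De f h = 2 ^ v * N f := by
  have hp' : Pl (fun x => |f x|) := by
    intro x
    rcases hp x with h | h | h <;> simp [h]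
  have := sum_F_sq hp'
  have h2 : N (fun x => |f x|) = N f := by unfold N; simp
  rw [h2] at this
  exact this

lemma R_ge {f : G v → ℤ} (hp : Pl f) (h : G v) : 2 ^ v * |De f h| ≤ R f h := by
  have h1 : (2:ℤ) ^ v * |De f h| = |2 ^ v * De f h| := by
    rw [abs_mul, abs_of_pos (by positivity : (0:ℤ) < 2 ^ v)]
  rw [h1, ← parseval_De hp]
  exact abs_sum_le_sum_abs _ _

lemma R_nonneg (f : G v → ℤ) (h : G v) : 0 ≤ R f h := sum_nonneg fun _ _ => abs_nonneg _

lemma sum_R (f : G v → ℤ) : ∑ h, R f h = (∑ u, |F f u|) * (∑ u, |F f u|) := by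
  unfold R
  rw [sum_comm, sum_mul]
  refine sum_congr rfl fun u _ => ?_
  rw [← sum_shift u, mul_sum]
  refine sum_congr rfl fun h _ => ?_
  rw [abs_mul, add_comm h u, ← add_assoc, g_add_self, zero_add]

lemma R_zero {f : G v → ℤ} (hp : Pl f) : R f 0 = 2 ^ v * N f := by
  rw [← sum_F_sq hp]; unfold R
  refine sum_congr rfl fun u _ => ?_
  rw [add_zero, abs_mul_self]

/-- flatness -/
def Flat (k : ℕ) (f : G v → ℤ) : Prop := ∀ u, F f u = 0 ∨ F f u = 2 ^ k ∨ F f u = - 2 ^ k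

lemma flat_of_lt {f : G v → ℤ} {k : ℕ} (hm : M k f) (h : ∀ u, |F f u| < 2 * 2 ^ k) : Flat k f := by
  intro u
  obtain ⟨a, ha⟩ := hm u
  have h1 := h u
  have hd : (0:ℤ) < 2 ^ k := by positivity
  rw [ha, abs_mul, abs_of_pos hd, mul_comm] at h1
  have h2 : |a| < 2 := lt_of_mul_lt_mul_right h1 hd.le
  rw [abs_lt] at h2
  have : a = 0 ∨ a = 1 ∨ a = -1 := by omega
  rcases this with rfl | rfl | rfl
  · left; simp [ha]
  · right; left; simp [ha]
  · right; right; simp [ha]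

lemma flat_sum_abs {f : G v → ℤ} {k : ℕ} (hp : Pl f) (hfl : Flat k f) :
    2 ^ k * ∑ u, |F f u| = 2 ^ v * N f := by
  rw [← sum_F_sq hp, mul_sum]
  have hd : (0:ℤ) < 2 ^ k := by positivity
  refine sum_congr rfl fun u _ => ?_
  rcases hfl u with h | h | h <;> rw [h] <;> simp [abs_of_pos hd]

lemma flat_sum_R {f : G v → ℤ} {k : ℕ} (hp : Pl f) (hfl : Flat k f) :
    (2 ^ k) ^ 2 * ∑ h, R f h = (2 ^ v * N f) ^ 2 := by
  rw [sum_R, ← flat_sum_abs hp hfl]; ring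

lemma L0 : ∀ (k : ℕ) (f : G v → ℤ), Pl f → M k f → 0 < N f → N f < 2 * 2 ^ k →
    ∃ i : ℕ, N f + 2 ^ i = 2 * 2 ^ k := by
  intro k
  induction k with
  | zero =>
    intro f _ _ h1 h2
    exact ⟨0, by norm_num at h2 ⊢; omega⟩
  | succ k ih =>
    intro f hp hm h1 h2
    have hd : (0:ℤ) < 2 ^ k := by positivity
    have hdd : (2:ℤ) ^ (k + 1) = 2 * 2 ^ k := by ring
    have hfl : Flat (k + 1) f := flat_of_lt hm fun u => lt_of_le_of_lt (F_le f u) h2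
    have hE : (0:ℤ) < 2 ^ v := by positivity
    by_cases hR : ∃ h : G v, h ≠ 0 ∧ R f h = 0
    · obtain ⟨h, _, hR⟩ := hR
      have hD : De f h = 0 := by
        have := R_ge hp h
        rw [hR] at this
        have h3 : |De f h| ≤ 0 := by
          by_contra hc; push Not at hc
          have := mul_pos hE hc; linarith
        exact abs_eq_zero.1 (le_antisymm h3 (abs_nonneg _))
      have hN := N_hf (Or.inl rfl : Sg 1) h f
      rw [hD] at hN
      obtain ⟨i, hi⟩ := ih (hf 1 h f) (Pl_hf h hp) (M_hf (Or.inl rfl) h hm) (by linarith)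
        (by rw [hdd] at h2; linarith)
      exact ⟨i + 1, by rw [hdd, pow_succ]; linarith⟩
    · push Not at hR
      have hN := N_ge hm h1
      set D := 2 * 2 ^ (k + 1) - N f with hDdef
      have key : ∀ h : G v, h ≠ 0 → 2 ^ v * D ≤ R f h := by
        intro h h0
        have hne := hR h h0
        have : ∃ u, F f u * F f (u + h) ≠ 0 := by
          by_contra hc; push Not at hc
          apply hne; unfold R; simp [hc]
        obtain ⟨u, hu⟩ := this
        have hs : ∃ s : ℤ, Sg s ∧ |F (hf s h f) u| = 2 ^ (k + 1) := by
          have hF1 := F_hf (Or.inl rfl : Sg 1) h f u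
          have hF2 := F_hf (Or.inr rfl : Sg (-1)) h f u
          have hd' : (0:ℤ) < 2 ^ (k + 1) := by positivity
          rcases hfl u with ha | ha | ha <;> rcases hfl (u + h) with hb | hb | hb <;>
            rw [ha, hb] at hu hF1 hF2 <;> simp only [mul_zero, zero_mul, ne_eq, not_true_eq_false] at hu
          · exact ⟨1, Or.inl rfl, by rw [show F (hf 1 h f) u = 2 ^ (k+1) by linarith, abs_of_pos hd']⟩
          · exact ⟨-1, Or.inr rfl, by rw [show F (hf (-1) h f) u = 2 ^ (k+1) by linarith, abs_of_pos hd']⟩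
          · exact ⟨-1, Or.inr rfl, by rw [show F (hf (-1) h f) u = -2 ^ (k+1) by linarith, abs_neg, abs_of_pos hd']⟩
          · exact ⟨1, Or.inl rfl, by rw [show F (hf 1 h f) u = -2 ^ (k+1) by linarith, abs_neg, abs_of_pos hd']⟩
        obtain ⟨s, hs, hFs⟩ := hs
        have h5 := F_le (hf s h f) u
        rw [hFs] at h5
        have h6 := N_hf hs h f
        have h7 : D ≤ |De f h| := by
          rcases hs with rfl | rfl
          · have := le_abs_self (De f h); linarith
          · have := neg_le_abs (De f h); linarith
        exact (mul_le_mul_of_nonneg_left h7 hE.le).trans (R_ge hp h)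
      have hsum : 2 ^ v * N f + (2 ^ v - 1) * (2 ^ v * D) ≤ ∑ h, R f h := by
        rw [← Finset.add_sum_erase univ (R f) (mem_univ 0), R_zero hp]
        have : ((univ : Finset (G v)).erase 0).card • (2 ^ v * D) ≤ ∑ h ∈ univ.erase 0, R f h :=
          card_nsmul_le_sum _ _ _ fun h hh => key h (ne_of_mem_erase hh)
        rw [nsmul_eq_mul, card_erase_of_mem (mem_univ _),
          Nat.cast_sub (card_pos.2 ⟨0, mem_univ _⟩), card_G] at this
        push_cast at this
        linarith
      have htot := flat_sum_R hp hfl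
      have hD4 : D < 4 := by
        set E : ℤ := 2 ^ v
        set d : ℤ := 2 ^ (k + 1)
        have hd0 : 0 < d := by positivity
        by_contra hc
        push Not at hc
        have hNd : N f = 2 * d - D := by linarith
        have hDd : D ≤ d := by linarith
        rw [hNd] at hsum htot
        have e1 : d ^ 2 * (E * (2 * d - D) + (E - 1) * (E * D)) ≤ (E * (2 * d - D)) ^ 2 := by
          rw [← htot]; exact mul_le_mul_of_nonneg_left hsum (by positivity)
        have e2 : E * (d ^ 2 * (2 * d - 2 * D) + E * (d ^ 2 * D - (2 * d - D) ^ 2)) ≤ 0 := by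
          linarith
        have e3 : 0 < d ^ 2 * D - (2 * d - D) ^ 2 := by
          nlinarith [mul_nonneg (sq_nonneg d) (by linarith : 0 ≤ D - 4)]
        have e4 : 0 ≤ d ^ 2 * (2 * d - 2 * D) := mul_nonneg (sq_nonneg d) (by linarith)
        have e5 : 0 < E * (d ^ 2 * D - (2 * d - D) ^ 2) := mul_pos hE e3
        have := mul_pos hE (add_pos_of_nonneg_of_pos e4 e5)
        linarith
      have hev := N_even hm
      refine ⟨1, ?_⟩
      have : (2:ℤ) ∣ D := by omega
      omega

end TT


namespace TT

open Finset
open scoped symmDiff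

variable {v : ℕ}

lemma pw {j k : ℕ} (h : (2:ℤ) ^ j < 2 ^ k) : 2 * (2:ℤ) ^ j ≤ 2 ^ k := by
  have h1 : j < k := (pow_lt_pow_iff_right₀ (by norm_num : (1:ℤ) < 2)).1 h
  calc 2 * (2:ℤ) ^ j = 2 ^ (j + 1) := by ring
    _ ≤ 2 ^ k := pow_le_pow_right₀ (by norm_num) h1

/-- elements constant on the support -/
def Tr (f : G v → ℤ) : AddSubgroup (G v) where
  carrier := {w | ∀ x y, f x ≠ 0 → f y ≠ 0 → chi w x = chi w y}
  zero_mem' := by intro x y _ _; rw [chi_zero, chi_zero]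
  add_mem' := by
    intro a b ha hb x y hx hy
    rw [chi_add, chi_add, ha x y hx hy, hb x y hx hy]
  neg_mem' := by
    intro a ha
    have : -a = a := by
      rw [neg_eq_iff_add_eq_zero, g_add_self]
    rw [this]; exact ha

lemma mem_Tr {f : G v → ℤ} {w : G v} :
    w ∈ Tr f ↔ ∀ x y, f x ≠ 0 → f y ≠ 0 → chi w x = chi w y := Iff.rfl

lemma card_subgroup (H : AddSubgroup (G v)) : ∃ a : ℕ, Nat.card H = 2 ^ a := by
  have h := AddSubgroup.card_addSubgroup_dvd_card H
  have h2 : Nat.card (G v) = 2 ^ v := by simp [ZMod.card]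
  rw [h2] at h
  obtain ⟨a, _, ha⟩ := (Nat.dvd_prime_pow Nat.prime_two).1 h
  exact ⟨a, ha⟩

lemma N_split (h : G v) (f : G v → ℤ) : N (hf 1 h f) + N (hf (-1) h f) = N f := by
  have h1 := N_hf (Or.inl rfl : Sg 1) h f
  have h2 := N_hf (Or.inr rfl : Sg (-1)) h f
  linarith

lemma N_split' {s : ℤ} (hs : Sg s) (h : G v) (f : G v → ℤ) :
    N (hf s h f) + N (hf (-s) h f) = N f := by
  have := N_split h f
  rcases hs with rfl | rfl
  · exact this
  · rw [neg_neg]; linarith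

lemma Tr_of_half {s : ℤ} (hs : Sg s) {h : G v} {f : G v → ℤ} (h0 : N (hf s h f) = 0) (x : G v)
    (hx : f x ≠ 0) : chi h x = -s := by
  have := N_eq_zero h0 x
  unfold hf at this
  split_ifs at this with h1
  · exact absurd this hx
  · rcases hs with rfl | rfl <;> rcases chi_cases h x with h2 | h2 <;> simp_all

lemma F_add_Tr {f : G v → ℤ} {w : G v} (hw : w ∈ Tr f) :
    ∃ s, Sg s ∧ ∀ u, F f (u + w) = s * F f u := by
  by_cases h : ∃ x, f x ≠ 0
  · obtain ⟨x, hx⟩ := h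
    refine ⟨chi w x, chi_cases w x, fun u => ?_⟩
    unfold F
    rw [mul_sum]
    refine sum_congr rfl fun y _ => ?_
    by_cases hy : f y = 0
    · simp [hy]
    · rw [chi_add, hw y x hy hx]; ring
  · push Not at h
    refine ⟨1, Or.inl rfl, fun u => ?_⟩
    unfold F; simp [h]

lemma group_lemma {g : G v → ℤ} {j : ℕ} (hm : M (j + 1) g) (hN : N g < 5 * 2 ^ j) (u0 : G v)
    (hu0 : |F g u0| = 4 * 2 ^ j) :
    ∃ a : ℕ, ((univ.filter fun u => |F g u| = 4 * 2 ^ j).card : ℤ) = 2 ^ a := by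
  have hd : (0:ℤ) < 2 ^ j := by positivity
  have key : ∀ u, |F g u| = 4 * 2 ^ j ↔ u + u0 ∈ Tr g := by
    intro u
    constructor
    · intro hu
      set w := u + u0
      have huw : u = u0 + w := by
        show u = u0 + (u + u0)
        rw [add_comm u u0, ← add_assoc, g_add_self, zero_add]
      have : ∃ s, Sg s ∧ F g (u0 + w) = s * F g u0 := by
        rw [← huw]
        rcases abs_eq_abs.1 (hu.trans hu0.symm) with h | h
        · exact ⟨1, Or.inl rfl, by rw [h]; ring⟩
        · exact ⟨-1, Or.inr rfl, by rw [h]; ring⟩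
      obtain ⟨s, hs, hF⟩ := this
      have h1 := F_hf hs w g u0
      have hss : s * s = 1 := by rcases hs with rfl | rfl <;> norm_num
      rw [hF, ← mul_assoc, hss] at h1
      have h2 := F_le (hf s w g) u0
      rw [show F (hf s w g) u0 = F g u0 by linarith, hu0] at h2
      have hs' : Sg (-s) := by rcases hs with rfl | rfl <;> simp [Sg]
      have h3 := N_split' hs w g
      have h4 := zero_of_small (M_hf hs' w hm) (by linarith)
      intro x y hx hy
      rw [Tr_of_half hs' h4 x hx, Tr_of_half hs' h4 y hy]
    · intro hu
      obtain ⟨s, hs, hF⟩ := F_add_Tr hu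
      have := hF u0
      rw [add_comm u u0, ← add_assoc, g_add_self, zero_add] at this
      rw [this, abs_mul, hu0]
      rcases hs with rfl | rfl <;> simp
  obtain ⟨a, ha⟩ := card_subgroup (Tr g)
  refine ⟨a, ?_⟩
  classical
  have : (univ.filter fun u => |F g u| = 4 * 2 ^ j).card = Nat.card (Tr g) := by
    rw [Nat.card_eq_fintype_card, Fintype.card_subtype]
    refine card_bij (fun u _ => u + u0) ?_ ?_ ?_
    · intro u hu
      simp only [mem_filter, mem_univ, true_and] at hu ⊢
      exact (key u).1 hu
    · intro a _ b _ h; exact add_right_cancel h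
    · intro b hb
      simp only [mem_filter, mem_univ, true_and] at hb
      refine ⟨b + u0, ?_, g_add_add _ _⟩
      simp only [mem_filter, mem_univ, true_and]
      rw [key, g_add_add]; exact hb
  rw [this, ha]; push_cast; rfl

def Ng (f : G v → ℤ) : Finset (G v) := univ.filter fun x => f x = -1

lemma mem_Ng {f : G v → ℤ} {x : G v} : x ∈ Ng f ↔ f x = -1 := by simp [Ng]

lemma negmass {g : G v → ℤ} (hp : Pl g) : N g = F g 0 + 2 * (Ng g).card := by
  have h : ((Ng g).card : ℤ) = ∑ x, if g x = -1 then 1 else 0 := by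
    unfold Ng; rw [card_filter]; push_cast; rfl
  rw [h]; unfold N F
  rw [mul_sum, ← sum_add_distrib]
  refine sum_congr rfl fun x _ => ?_
  rw [chi_zero]
  rcases hp x with h | h | h <;> rw [h] <;> norm_num

/-- half with negatives -/
lemma Ng_hf (s : ℤ) (u : G v) (f : G v → ℤ) : Ng (hf s u f) = (Ng f).filter fun x => chi u x = s := by
  ext x
  simp only [mem_filter, mem_Ng]
  unfold hf
  split_ifs with h
  · simp [h]
  · simp [h]

def S (f : G v → ℤ) (u : G v) : Finset (G v) := (Ng f).filter fun x => chi u x * F f u < 0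

lemma mem_S {f : G v → ℤ} {u x : G v} {d e : ℤ} (hd : 0 < d) (he : Sg e) (hF : F f u = e * d) :
    x ∈ S f u ↔ f x = -1 ∧ chi u x = -e := by
  unfold S
  rw [mem_filter, mem_Ng, hF]
  refine and_congr_right fun _ => ?_
  rcases he with rfl | rfl <;> rcases chi_cases u x with h | h <;> rw [h] <;> norm_num <;> linarith

lemma S_eq {f : G v → ℤ} {u : G v} {d e : ℤ} (hd : 0 < d) (he : Sg e) (hF : F f u = e * d) :
    S f u = Ng (hf (-e) u f) := by
  ext x
  rw [mem_S hd he hF, Ng_hf, mem_filter, mem_Ng]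

lemma Sg_neg {s : ℤ} (hs : Sg s) : Sg (-s) := by
  rcases hs with rfl | rfl <;> simp [Sg]
lemma Sg_sq {s : ℤ} (hs : Sg s) : s * s = 1 := by
  rcases hs with rfl | rfl <;> norm_num
lemma Sg_mul {s t : ℤ} (hs : Sg s) (ht : Sg t) : Sg (s * t) := by
  rcases hs with rfl | rfl <;> rcases ht with rfl | rfl <;> simp [Sg]

/-- L0 for `norm = a * 2^k' + 2 q` -/
lemma L0q {f : G v → ℤ} {k : ℕ} (hp : Pl f) (hm : M k f) {q : ℤ} (h0 : 0 < N f)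
    (h : N f = 2 * q) (h1 : N f < 2 * 2 ^ k) : ∃ j : ℕ, q + 2 ^ j = 2 ^ k := by
  obtain ⟨i, hi⟩ := L0 k f hp hm h0 h1
  rcases i with _ | i
  · exfalso; rw [pow_zero] at hi; omega
  · refine ⟨i, ?_⟩
    rw [pow_succ] at hi; linarith

lemma cellF {s t : ℤ} (hs : Sg s) (ht : Sg t) (u w : G v) (f : G v → ℤ) :
    4 * F (hf t w (hf s u f)) 0 = F f 0 + s * F f u + t * F f w + s * t * F f (u + w) := by
  have h1 := F_hf ht w (hf s u f) 0
  have h2 := F_hf hs u f 0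
  have h3 := F_hf hs u f w
  rw [zero_add] at h1 h2
  rw [add_comm w u] at h3
  linear_combination 2 * h1 + h2 + t * h3

set_option linter.unusedSectionVars false
section L2
variable {f : G v → ℤ} {k : ℕ} (hp : Pl f) (hm : M (k + 2) f) (hF0 : F f 0 = 8 * 2 ^ k)
  (hN : N f < 10 * 2 ^ k)
include hp hm hF0 hN

lemma L2_Q : ((Ng f).card : ℤ) < 2 ^ k := by
  have := negmass hp; linarith

lemma L2_single {u : G v} {e : ℤ} (he : Sg e) (hF : F f u = e * (4 * 2 ^ k)) :
    ∃ j : ℕ, ((S f u).card : ℤ) + 2 ^ j = 2 ^ k := by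
  have hd : (0:ℤ) < 2 ^ k := by positivity
  have hQ := L2_Q hp hm hF0 hN
  have h1 := F_hf (Sg_neg he) u f 0
  rw [zero_add, hF, hF0, neg_mul, ← mul_assoc, Sg_sq he] at h1
  have h2 := negmass (Pl_hf (s := -e) u hp)
  rw [← S_eq (by positivity : (0:ℤ) < 4 * 2 ^ k) he hF] at h2
  have h3 : ((S f u).card : ℤ) ≤ (Ng f).card := by exact_mod_cast card_filter_le _ _
  obtain ⟨j, hj⟩ := L0q (k := k + 1) (q := 2 ^ k + (S f u).card) (Pl_hf (s := -e) u hp)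
    (M_hf (Sg_neg he) u hm) (by linarith) (by linarith) (by rw [pow_succ]; linarith)
  exact ⟨j, by rw [pow_succ] at hj; linarith⟩

lemma L2_big {u : G v} {e : ℤ} (he : Sg e) (hF : F f u = e * (4 * 2 ^ k)) (hne : (S f u).Nonempty) :
    (2:ℤ) ^ k ≤ 2 * (S f u).card := by
  obtain ⟨j, hj⟩ := L2_single hp hm hF0 hN he hF
  have : (0:ℤ) < (S f u).card := by exact_mod_cast card_pos.2 hne
  have := pw (j := j) (k := k) (by linarith)
  linarith

lemma L2_double {u : G v} {e : ℤ} (he : Sg e) (hF : F f u = e * (8 * 2 ^ k)) (x : G v)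
    (hx : f x ≠ 0) : chi u x = e := by
  have hd : (0:ℤ) < 2 ^ k := by positivity
  have hQ := L2_Q hp hm hF0 hN
  have h1 := F_hf (Sg_neg he) u f 0
  rw [zero_add, hF, hF0, neg_mul, ← mul_assoc, Sg_sq he] at h1
  have h2 := negmass (Pl_hf (s := -e) u hp)
  rw [Ng_hf] at h2
  have h3 : (((Ng f).filter fun x => chi u x = -e).card : ℤ) ≤ (Ng f).card := by
    exact_mod_cast card_filter_le _ _
  have h4 := zero_of_small (M_hf (Sg_neg he) u hm) (by rw [pow_succ]; linarith)
  rw [Tr_of_half (Sg_neg he) h4 x hx, neg_neg]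

lemma L2_vals (u : G v) : F f u = 0 ∨ ∃ e, Sg e ∧ (F f u = e * (4 * 2 ^ k) ∨ F f u = e * (8 * 2 ^ k)) := by
  have hd : (0:ℤ) < 2 ^ k := by positivity
  obtain ⟨a, ha⟩ := hm u
  have h1 := F_le f u
  have h5 : (2:ℤ) ^ (k + 2) = 4 * 2 ^ k := by ring
  rw [h5] at ha
  rw [ha, abs_mul, abs_of_pos (by positivity)] at h1
  have h2 : |a| < 3 := by nlinarith
  rw [abs_lt] at h2
  have : a = 0 ∨ a = 1 ∨ a = -1 ∨ a = 2 ∨ a = -2 := by omega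
  rcases this with rfl | rfl | rfl | rfl | rfl
  · left; linarith
  · right; exact ⟨1, Or.inl rfl, Or.inl (by linarith)⟩
  · right; exact ⟨-1, Or.inr rfl, Or.inl (by linarith)⟩
  · right; exact ⟨1, Or.inl rfl, Or.inr (by linarith)⟩
  · right; exact ⟨-1, Or.inr rfl, Or.inr (by linarith)⟩

lemma L2_cover {x : G v} (hx : f x = -1) : ∃ u e, Sg e ∧ F f u = e * (4 * 2 ^ k) ∧ x ∈ S f u := by
  have hd : (0:ℤ) < 2 ^ k := by positivity
  have h1 := F_inv f x
  have h2 : ∃ u, F f u * chi u x < 0 := by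
    by_contra hc; push Not at hc
    have h3 : 0 ≤ ∑ u, F f u * chi u x := sum_nonneg fun u _ => hc u
    rw [h1, hx] at h3
    have : (0:ℤ) < 2 ^ v := by positivity
    linarith
  obtain ⟨u, hu⟩ := h2
  rcases L2_vals hp hm hF0 hN u with h | ⟨e, he, h | h⟩
  · rw [h, zero_mul] at hu; exact absurd hu (lt_irrefl _)
  · refine ⟨u, e, he, h, ?_⟩
    unfold S
    rw [mem_filter, mem_Ng]
    exact ⟨hx, by rw [mul_comm]; exact hu⟩
  · exfalso
    have h3 := L2_double hp hm hF0 hN he h x (by rw [hx]; norm_num)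
    rw [h, h3] at hu
    have := Sg_sq he
    nlinarith

lemma L2_pair {u w : G v} {e t : ℤ} (he : Sg e) (ht : Sg t) (hu : F f u = e * (4 * 2 ^ k))
    (hw : F f w = t * (4 * 2 ^ k)) (hb : (S f u \ S f w).Nonempty) (hc : (S f w \ S f u).Nonempty) :
    F f (u + w) = e * t * (4 * 2 ^ k) ∧ 2 * ((S f u).card : ℤ) = 2 ^ k ∧ 2 * ((S f w).card : ℤ) = 2 ^ k := by
  have hd : (0:ℤ) < 2 ^ k := by positivity
  have hQ := L2_Q hp hm hF0 hN
  have hdd : (0:ℤ) < 4 * 2 ^ k := by positivity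
  have hqu := L2_big hp hm hF0 hN he hu (hb.mono sdiff_subset)
  have hqw := L2_big hp hm hF0 hN ht hw (hc.mono sdiff_subset)
  obtain ⟨ju, hju⟩ := L2_single hp hm hF0 hN he hu
  obtain ⟨jw, hjw⟩ := L2_single hp hm hF0 hN ht hw
  set a : ℤ := ((S f u ∩ S f w).card : ℤ) with hadef
  set b : ℤ := ((S f u \ S f w).card : ℤ) with hbdef
  set c : ℤ := ((S f w \ S f u).card : ℤ) with hcdef
  have hb0 : 0 < b := Nat.cast_pos.2 (card_pos.2 hb)
  have hc0 : 0 < c := Nat.cast_pos.2 (card_pos.2 hc)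
  have hab : ((S f u).card : ℤ) = a + b := by
    have := card_sdiff_add_card_inter (S f u) (S f w)
    rw [hadef, hbdef]; exact_mod_cast (by omega)
  have hac : ((S f w).card : ℤ) = a + c := by
    have := card_sdiff_add_card_inter (S f w) (S f u)
    rw [inter_comm] at this
    rw [hadef, hcdef]; exact_mod_cast (by omega)
  have habc : a + b + c ≤ (Ng f).card := by
    have h1 : (S f u ∪ S f w).card ≤ (Ng f).card :=
      card_le_card (union_subset (filter_subset _ _) (filter_subset _ _))
    have h2 := card_union_add_card_inter (S f u) (S f w)
    have h3 : (((S f u ∪ S f w).card + (S f u ∩ S f w).card : ℕ) : ℤ) = ((S f u).card + (S f w).card : ℕ) := by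
      rw [h2]
    push_cast at h3
    have h4 : ((S f u ∪ S f w).card : ℤ) ≤ (Ng f).card := by exact_mod_cast h1
    linarith
  rw [hab] at hqu hju
  rw [hac] at hqw hjw
  have ha0 : 0 < a := by linarith
  -- cells
  have hes := Sg_sq he
  have hts := Sg_sq ht
  obtain ⟨η, hη⟩ : ∃ η, F f (u + w) = e * t * (η * (4 * 2 ^ k)) := by
    obtain ⟨η, hη⟩ := hm (u + w)
    refine ⟨e * t * η, ?_⟩
    rw [hη, pow_add]
    linear_combination (- 2 ^ k * 4 * η * t * t) * hes - 2 ^ k * 4 * η * hts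
  have cFF := cellF (Sg_neg he) (Sg_neg ht) u w f
  have cFE := cellF (Sg_neg he) ht u w f
  have cEF := cellF he (Sg_neg ht) u w f
  rw [hF0, hu, hw, hη] at cFF cFE cEF
  have cFF' : F (hf (-t) w (hf (-e) u f)) 0 = η * 2 ^ k := by
    refine mul_left_cancel₀ (four_ne_zero : (4:ℤ) ≠ 0) ?_
    linear_combination cFF + 4 * ((-1 + η * t * t) * 2 ^ k) * hes + 4 * (-1 + η) * 2 ^ k * hts
  have cFE' : F (hf t w (hf (-e) u f)) 0 = (2 - η) * 2 ^ k := by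
    refine mul_left_cancel₀ (four_ne_zero : (4:ℤ) ≠ 0) ?_
    linear_combination cFE + 4 * ((-1 - η * t * t) * 2 ^ k) * hes + 4 * (1 - η) * 2 ^ k * hts
  have cEF' : F (hf (-t) w (hf e u f)) 0 = (2 - η) * 2 ^ k := by
    refine mul_left_cancel₀ (four_ne_zero : (4:ℤ) ≠ 0) ?_
    linear_combination cEF + 4 * ((1 - η * t * t) * 2 ^ k) * hes + 4 * (-1 - η) * 2 ^ k * hts
  have cross : ∀ x, chi w x = -t ∨ chi w x = t := by
    intro x; rcases ht with rfl | rfl <;> rcases chi_cases w x with h | h <;> simp [h]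
  have crosse : ∀ x, chi u x = -e ∨ chi u x = e := by
    intro x; rcases he with rfl | rfl <;> rcases chi_cases u x with h | h <;> simp [h]
  have hee : e ≠ -e := by rcases he with rfl | rfl <;> norm_num
  have htt : t ≠ -t := by rcases ht with rfl | rfl <;> norm_num
  have nFF := negmass (Pl_hf (s := -t) w (Pl_hf (s := -e) u hp))
  have nFE := negmass (Pl_hf (s := t) w (Pl_hf (s := -e) u hp))
  have nEF := negmass (Pl_hf (s := -t) w (Pl_hf (s := e) u hp))
  have sFF : Ng (hf (-t) w (hf (-e) u f)) = S f u ∩ S f w := by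
    ext x
    rw [Ng_hf, mem_filter, Ng_hf, mem_filter, mem_inter, mem_S hdd he hu, mem_S hdd ht hw, mem_Ng]
    tauto
  have sFE : Ng (hf t w (hf (-e) u f)) = S f u \ S f w := by
    ext x
    rw [Ng_hf, mem_filter, Ng_hf, mem_filter, mem_sdiff, mem_S hdd he hu, mem_S hdd ht hw, mem_Ng]
    rcases cross x with h | h <;> rw [h]
    · simp [htt.symm]; tauto
    · simp [htt]; 
  have sEF : Ng (hf (-t) w (hf e u f)) = S f w \ S f u := by
    ext x
    rw [Ng_hf, mem_filter, Ng_hf, mem_filter, mem_sdiff, mem_S hdd he hu, mem_S hdd ht hw, mem_Ng]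
    rcases crosse x with h | h <;> rw [h]
    · simp [hee.symm]; tauto
    · simp [hee]
  rw [cFF', sFF] at nFF
  rw [cFE', sFE] at nFE
  rw [cEF', sEF] at nEF
  have mFF := M_hf (Sg_neg ht) w (M_hf (Sg_neg he) u hm)
  have mFE := M_hf ht w (M_hf (Sg_neg he) u hm)
  have mEF := M_hf (Sg_neg ht) w (M_hf he u hm)
  have bFF := F_le (hf (-t) w (hf (-e) u f)) 0
  rw [cFF', nFF, abs_le, ← hadef] at bFF
  have bFE := F_le (hf t w (hf (-e) u f)) 0
  rw [cFE', nFE, abs_le, ← hbdef] at bFE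
  rw [← hadef] at nFF
  rw [← hbdef] at nFE
  rw [← hcdef] at nEF
  have hη0 : 0 ≤ η := by
    by_contra hc; push Not at hc
    have : η * 2 ^ k ≤ -1 * 2 ^ k := mul_le_mul_of_nonneg_right (by omega) hd.le
    linarith
  have hη2 : η ≤ 2 := by
    by_contra hc; push Not at hc
    have : (2 - η) * 2 ^ k ≤ -1 * 2 ^ k := mul_le_mul_of_nonneg_right (by omega) hd.le
    linarith
  have : η = 0 ∨ η = 1 ∨ η = 2 := by omega
  rcases this with rfl | rfl | rfl
  · exfalso
    obtain ⟨j, hj⟩ := L0q (q := a) (Pl_hf (s := -t) w (Pl_hf (s := -e) u hp)) mFF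
      (by linarith) (by linarith) (by linarith)
    have h1 := pw (j := ju) (k := j) (by linarith)
    have h2 := pw (j := jw) (k := j) (by linarith)
    linarith
  · refine ⟨by rw [hη]; ring, ?_⟩
    obtain ⟨i, hi⟩ := L0 _ _ (Pl_hf (s := t) w (Pl_hf (s := -e) u hp)) mFE
      (by linarith) (by linarith)
    obtain ⟨i', hi'⟩ := L0 _ _ (Pl_hf (s := -t) w (Pl_hf (s := e) u hp)) mEF
      (by linarith) (by linarith)
    have h1 := pw (j := i) (k := k) (by linarith)
    have h2 := pw (j := i') (k := k) (by linarith)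
    have h3 : (2:ℤ) ^ k ≤ 2 * 2 ^ ju := by
      have := pw (j := k) (k := ju + 2) (by rw [pow_add]; linarith)
      rw [pow_add] at this; linarith
    have h4 : (2:ℤ) ^ k ≤ 2 * 2 ^ jw := by
      have := pw (j := k) (k := jw + 2) (by rw [pow_add]; linarith)
      rw [pow_add] at this; linarith
    constructor <;> linarith
  · exfalso
    have h1 := zero_of_small mFE (by linarith)
    linarith

lemma L2_main : ∃ j : ℕ, ((Ng f).card : ℤ) + 2 ^ j = 2 ^ k := by
  classical
  have hd : (0:ℤ) < 2 ^ k := by positivity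
  have hdd : (0:ℤ) < 4 * 2 ^ k := by positivity
  have hQ := L2_Q hp hm hF0 hN
  rcases (Ng f).eq_empty_or_nonempty with hem | hne
  · exact ⟨k, by rw [hem]; simp⟩
  set U : Finset (G v) := univ.filter fun u => (∃ e, Sg e ∧ F f u = e * (4 * 2 ^ k)) ∧ (S f u).Nonempty
    with hU
  have hUm : ∀ u, u ∈ U ↔ (∃ e, Sg e ∧ F f u = e * (4 * 2 ^ k)) ∧ (S f u).Nonempty := by
    intro u; simp [hU]
  have cover : ∀ x ∈ Ng f, ∃ u ∈ U, x ∈ S f u := by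
    intro x hx
    obtain ⟨u, e, he, hF, hxu⟩ := L2_cover hp hm hF0 hN (mem_Ng.1 hx)
    exact ⟨u, (hUm u).2 ⟨⟨e, he, hF⟩, ⟨x, hxu⟩⟩, hxu⟩
  have hUne : U.Nonempty := by
    obtain ⟨x, hx⟩ := hne
    obtain ⟨u, hu, _⟩ := cover x hx
    exact ⟨u, hu⟩
  obtain ⟨u, huU, hmax⟩ := exists_max_image U (fun u => (S f u).card) hUne
  obtain ⟨⟨e, he, hFu⟩, hSu⟩ := (hUm u).1 huU
  have hpair : ∀ w ∈ U, ∀ w' ∈ U, S f w ≠ S f w' → (S f w').card ≤ (S f w).card →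
      (2 * ((S f w).card : ℤ) ≠ 2 ^ k ∨ (S f w').card = (S f w).card) →
      S f w' ⊆ S f w ∧ 2 * ((S f w).card : ℤ) ≠ 2 ^ k ∨ (∃ u, (u = w + w') ∧ 2 * ((S f w).card : ℤ) = 2 ^ k ∧ u ∈ U ∧ S f u = S f w ∆ S f w') := by
    intro w hw w' hw' hne hle hor
    obtain ⟨⟨e, he, hFu⟩, hSu⟩ := (hUm w).1 hw
    obtain ⟨⟨e', he', hFu'⟩, hSu'⟩ := (hUm w').1 hw'
    by_cases hs : S f w' ⊆ S f w
    · left; refine ⟨hs, ?_⟩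
      rcases hor with h | h
      · exact h
      · exact absurd (eq_of_subset_of_card_le hs h.ge).symm hne
    · have h1 : (S f w' \ S f w).Nonempty := by
        rw [sdiff_nonempty]; exact hs
      have h2 : (S f w \ S f w').Nonempty := by
        rw [sdiff_nonempty]; intro hs'
        exact hne (eq_of_subset_of_card_le hs' hle)
      obtain ⟨ha, hb, hc⟩ := L2_pair hp hm hF0 hN he he' hFu hFu' h2 h1
      right
      refine ⟨w + w', rfl, hb, ?_⟩
      have hee := Sg_mul he he'
      have hSs : S f (w + w') = S f w ∆ S f w' := by
        ext x
        rw [mem_symmDiff, mem_S hdd hee ha, mem_S hdd he hFu, mem_S hdd he' hFu', chi_add]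
        rcases he with rfl | rfl <;> rcases he' with rfl | rfl <;>
          rcases chi_cases w x with h | h <;> rcases chi_cases w' x with h' | h' <;>
          rw [h, h'] <;> norm_num
      refine ⟨(hUm _).2 ⟨⟨_, hee, ha⟩, ?_⟩, hSs⟩
      rw [hSs]
      obtain ⟨x, hx⟩ := h1
      exact ⟨x, by rw [mem_symmDiff]; right; exact mem_sdiff.1 hx⟩
  by_cases hhalf : 2 * ((S f u).card : ℤ) = 2 ^ k
  · -- all have half size
    have hall : ∀ w ∈ U, 2 * ((S f w).card : ℤ) = 2 ^ k := by
      intro w hw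
      obtain ⟨⟨e, he, hFu⟩, hSu⟩ := (hUm w).1 hw
      have h1 := L2_big hp hm hF0 hN he hFu hSu
      have h2 : ((S f w).card : ℤ) ≤ (S f u).card := by exact_mod_cast hmax w hw
      linarith
    set C : Finset (Finset (G v)) := insert ∅ (U.image (S f)) with hC
    have hCU : ∀ A ∈ C, A = ∅ ∨ ∃ w ∈ U, S f w = A := by
      intro A hA
      rw [hC, mem_insert, mem_image] at hA
      exact hA
    have hempty : ∅ ∈ C := mem_insert_self _ _
    have hUC : ∀ w ∈ U, S f w ∈ C := fun w hw => mem_insert_of_mem (mem_image_of_mem _ hw)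
    have hclosed : ∀ A ∈ C, ∀ w ∈ U, A ∆ S f w ∈ C := by
      intro A hA w hw
      rcases hCU A hA with rfl | ⟨w', hw', rfl⟩
      · rw [← bot_eq_empty, bot_symmDiff]; exact hUC w hw
      · by_cases heq : S f w' = S f w
        · rw [heq, symmDiff_self]; exact hempty
        · have hcc : (S f w).card = (S f w').card := by
            have h1 := hall w hw
            have h2 := hall w' hw'
            have : ((S f w).card : ℤ) = (S f w').card := by linarith
            exact_mod_cast this
          rcases hpair w' hw' w hw heq hcc.le (Or.inr hcc) with h | ⟨z, _, _, hz, hSz⟩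
          · exact absurd (hall w' hw') h.2
          · rw [← hSz]; exact hUC z hz
    have hhalfx : ∀ x ∈ Ng f, 2 * (C.filter fun A => x ∈ A).card = C.card := by
      intro x hx
      obtain ⟨w, hw, hxw⟩ := cover x hx
      have h1 : (C.filter fun A => x ∈ A).card = (C.filter fun A => ¬ x ∈ A).card := by
        refine card_bij (fun A _ => A ∆ S f w) ?_ ?_ ?_
        · intro A hA
          rw [mem_filter] at hA ⊢
          refine ⟨hclosed A hA.1 w hw, ?_⟩
          rw [mem_symmDiff]; tauto
        · intro A _ B _ h
          exact symmDiff_left_injective _ h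
        · intro A hA
          rw [mem_filter] at hA
          refine ⟨A ∆ S f w, ?_, symmDiff_symmDiff_cancel_right _ _⟩
          rw [mem_filter]
          refine ⟨hclosed A hA.1 w hw, ?_⟩
          rw [mem_symmDiff]; tauto
      have h2 := card_filter_add_card_filter_not (s := C) (fun A => x ∈ A)
      omega
    have hcount : ∑ A ∈ C, A.card = ∑ x ∈ Ng f, (C.filter fun A => x ∈ A).card := by
      have : ∀ A ∈ C, A.card = ((Ng f).filter fun x => x ∈ A).card := by
        intro A hA
        congr 1
        ext x
        rw [mem_filter]
        refine ⟨fun h => ⟨?_, h⟩, fun h => h.2⟩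
        rcases hCU A hA with rfl | ⟨w', hw', rfl⟩
        · simp at h
        · exact (mem_filter.1 h).1
      rw [sum_congr rfl this]
      exact sum_card_bipartiteAbove_eq_sum_card_bipartiteBelow (fun (A : Finset (G v)) x => x ∈ A)
    have hl : 2 * ∑ A ∈ C, (A.card : ℤ) = ((C.card : ℤ) - 1) * 2 ^ k := by
      rw [← add_sum_erase C _ hempty]
      rw [card_empty, Nat.cast_zero, zero_add, mul_sum]
      rw [sum_congr rfl (g := fun _ => (2:ℤ) ^ k)]
      · rw [sum_const, nsmul_eq_mul, card_erase_of_mem hempty, Nat.cast_sub (card_pos.2 ⟨_, hempty⟩)]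
        push_cast; rfl
      · intro A hA
        rw [mem_erase] at hA
        rcases hCU A hA.2 with h | ⟨w', hw', rfl⟩
        · exact absurd h hA.1
        · exact hall w' hw'
    have hr : 2 * ∑ x ∈ Ng f, ((C.filter fun A => x ∈ A).card : ℤ) = (Ng f).card * C.card := by
      rw [mul_sum]
      rw [sum_congr rfl (g := fun _ => (C.card : ℤ))]
      · rw [sum_const, nsmul_eq_mul]
      · intro x hx; exact_mod_cast hhalfx x hx
    have hcount' : ∑ A ∈ C, (A.card : ℤ) = ∑ x ∈ Ng f, ((C.filter fun A => x ∈ A).card : ℤ) := by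
      exact_mod_cast hcount
    have hfin : ((2:ℤ) ^ k - (Ng f).card) * C.card = 2 ^ k := by
      rw [hcount', hr] at hl
      linarith
    have hpos : (0:ℤ) < 2 ^ k - (Ng f).card := by linarith
    obtain ⟨r, hr⟩ := Int.eq_ofNat_of_zero_le hpos.le
    have hdv : r ∣ 2 ^ k := by
      have h5 : (r:ℤ) ∣ ((2 ^ k : ℕ) : ℤ) := by
        push_cast; rw [← hr]; exact ⟨_, hfin.symm⟩
      exact_mod_cast h5
    obtain ⟨j, _, hj⟩ := (Nat.dvd_prime_pow Nat.prime_two).1 hdv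
    refine ⟨j, ?_⟩
    rw [hj] at hr; push_cast at hr; linarith
  · have hsub : Ng f ⊆ S f u := by
      intro x hx
      obtain ⟨w, hw, hxw⟩ := cover x hx
      by_cases heq : S f u = S f w
      · rw [heq]; exact hxw
      · rcases hpair u huU w hw heq (hmax w hw) (Or.inl hhalf) with h | ⟨_, _, h, _⟩
        · exact h.1 hxw
        · exact absurd h hhalf
    have heq : S f u = Ng f := subset_antisymm (filter_subset _ _) hsub
    rw [← heq]
    exact L2_single hp hm hF0 hN he hFu

end L2

lemma L2 {f : G v → ℤ} {k : ℕ} (hp : Pl f) (hm : M (k + 2) f) (hN : N f < 10 * 2 ^ k) (u0 : G v)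
    (hu0 : |F f u0| = 8 * 2 ^ k) : ∃ i : ℕ, N f + 2 * 2 ^ i = 10 * 2 ^ k := by
  obtain ⟨s, hs, hF⟩ : ∃ s, Sg s ∧ F f u0 = s * (8 * 2 ^ k) := by
    rcases (abs_eq (by positivity)).1 hu0 with h | h
    · exact ⟨1, Or.inl rfl, by rw [h]; ring⟩
    · exact ⟨-1, Or.inr rfl, by rw [h]; ring⟩
  set g : G v → ℤ := fun x => s * chi u0 x * f x with hg
  have hFg : ∀ u, F g u = s * F f (u + u0) := by
    intro u; unfold F; rw [mul_sum]
    refine sum_congr rfl fun x _ => ?_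
    rw [chi_add, hg]; ring
  have hgs : ∀ x, Sg (s * chi u0 x) := fun x => Sg_mul hs (chi_cases _ _)
  have hpg : Pl g := by
    intro x
    rcases hgs x with h | h <;> rcases hp x with h' | h' | h' <;> simp [hg, h, h']
  have hNg : N g = N f := by
    unfold N
    refine sum_congr rfl fun x _ => ?_
    rcases hgs x with h | h <;> simp [hg, h]
  have hmg : M (k + 2) g := by
    intro u; rw [hFg]; exact Dvd.dvd.mul_left (hm _) _
  have hF0 : F g 0 = 8 * 2 ^ k := by
    rw [hFg, zero_add, hF, ← mul_assoc, Sg_sq hs, one_mul]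
  obtain ⟨j, hj⟩ := L2_main hpg hmg hF0 (by rw [hNg]; exact hN)
  have := negmass hpg
  exact ⟨j, by rw [← hNg]; linarith⟩

end TT


namespace TT

open Finset

variable {v : ℕ}

def GoodD (D : ℤ) : Prop := (∃ i : ℕ, D = 2 ^ i) ∨ (∃ i : ℕ, D = 3 * 2 ^ i)

def PP (v k : ℕ) : Prop := ∀ f : G v → ℤ, Pl f → M k f → 2 * 2 ^ k ≤ N f → 2 * N f < 5 * 2 ^ k →
  GoodD (5 * 2 ^ k - 2 * N f)

def nn (k : ℕ) (f : G v → ℤ) (s : ℤ) (h : G v) : ℤ :=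
  ((univ.filter fun u => F f u * F f (u + h) = s * (2 ^ k) ^ 2).card : ℤ)

lemma nn_nonneg (k : ℕ) (f : G v → ℤ) (s : ℤ) (h : G v) : 0 ≤ nn k f s h := by
  unfold nn; positivity

lemma nn_eq (k : ℕ) (f : G v → ℤ) (s : ℤ) (h : G v) :
    nn k f s h = ∑ u, if F f u * F f (u + h) = s * (2 ^ k) ^ 2 then 1 else 0 := by
  unfold nn; rw [card_filter]; push_cast; rfl

lemma nn_De {k : ℕ} {f : G v → ℤ} (hp : Pl f) (hfl : Flat k f) (h : G v) :
    (2 ^ k) ^ 2 * (nn k f 1 h - nn k f (-1) h) = 2 ^ v * De f h := by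
  rw [← parseval_De hp, nn_eq, nn_eq, ← sum_sub_distrib, mul_sum]
  refine sum_congr rfl fun u _ => ?_
  have hd : (0:ℤ) < (2 ^ k) ^ 2 := by positivity
  have h1 : ¬ (0:ℤ) = (2 ^ k) ^ 2 := by linarith
  have h2 : ¬ (0:ℤ) = -(2 ^ k) ^ 2 := by linarith
  have h3 : ¬ (2 ^ k) ^ 2 = -((2:ℤ) ^ k) ^ 2 := by linarith
  have h4 : ¬ -(2 ^ k) ^ 2 = ((2:ℤ) ^ k) ^ 2 := by linarith
  have : F f u * F f (u + h) = 0 ∨ F f u * F f (u + h) = (2 ^ k) ^ 2 ∨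
      F f u * F f (u + h) = - (2 ^ k) ^ 2 := by
    rcases hfl u with ha | ha | ha <;> rcases hfl (u + h) with hb | hb | hb <;> rw [ha, hb] <;> 
      ring_nf <;> simp
  rw [one_mul, neg_one_mul]
  rcases this with h5 | h5 | h5 <;> rw [h5]
  · rw [if_neg h1, if_neg h2]; ring
  · rw [if_pos rfl, if_neg h3]; ring
  · rw [if_pos rfl, if_neg h4]; ring

lemma nn_R {k : ℕ} {f : G v → ℤ} (hfl : Flat k f) (h : G v) :
    (2 ^ k) ^ 2 * (nn k f 1 h + nn k f (-1) h) = R f h := by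
  unfold R
  rw [nn_eq, nn_eq, ← sum_add_distrib, mul_sum]
  refine sum_congr rfl fun u _ => ?_
  have hd : (0:ℤ) < (2 ^ k) ^ 2 := by positivity
  have h1 : ¬ (0:ℤ) = (2 ^ k) ^ 2 := by linarith
  have h2 : ¬ (0:ℤ) = -(2 ^ k) ^ 2 := by linarith
  have h3 : ¬ (2 ^ k) ^ 2 = -((2:ℤ) ^ k) ^ 2 := by linarith
  have h4 : ¬ -(2 ^ k) ^ 2 = ((2:ℤ) ^ k) ^ 2 := by linarith
  have : F f u * F f (u + h) = 0 ∨ F f u * F f (u + h) = (2 ^ k) ^ 2 ∨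
      F f u * F f (u + h) = - (2 ^ k) ^ 2 := by
    rcases hfl u with ha | ha | ha <;> rcases hfl (u + h) with hb | hb | hb <;> rw [ha, hb] <;> 
      ring_nf <;> simp
  rw [one_mul, neg_one_mul]
  rcases this with h5 | h5 | h5 <;> rw [h5]
  · rw [if_neg h1, if_neg h2, abs_zero]; ring
  · rw [if_pos rfl, if_neg h3, abs_of_pos hd]; ring
  · rw [if_pos rfl, if_neg h4, abs_neg, abs_of_pos hd]; ring

lemma nn_De' {k : ℕ} {f : G v → ℤ} (hp : Pl f) (hfl : Flat k f) {s : ℤ} (hs : Sg s) (h : G v) :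
    (2 ^ k) ^ 2 * (nn k f s h - nn k f (-s) h) = 2 ^ v * (s * De f h) := by
  have := nn_De hp hfl h
  rcases hs with rfl | rfl
  · rw [this]; ring
  · rw [neg_neg]; linarith

lemma nn_R' {k : ℕ} {f : G v → ℤ} (hfl : Flat k f) {s : ℤ} (hs : Sg s) (h : G v) :
    (2 ^ k) ^ 2 * (nn k f s h + nn k f (-s) h) = R f h := by
  have := nn_R hfl h
  rcases hs with rfl | rfl
  · exact this
  · rw [neg_neg]; linarith

lemma nn_iff {k : ℕ} {f : G v → ℤ} (hfl : Flat k f) {s : ℤ} (hs : Sg s) (h u : G v) :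
    F f u * F f (u + h) = s * (2 ^ k) ^ 2 ↔ |F (hf s h f) u| = 2 ^ k := by
  have hd : (0:ℤ) < 2 ^ k := by positivity
  have h1 := F_hf hs h f u
  have hfa := hfl u
  have hfb := hfl (u + h)
  clear hfl
  generalize F (hf s h f) u = z at *
  generalize F f u = a at *
  generalize F f (u + h) = b at *
  generalize (2:ℤ) ^ k = d at *
  have hz : |z| = d ↔ (2 * z = 2 * d ∨ 2 * z = -(2 * d)) := by
    rw [abs_eq hd.le]; constructor <;> intro h <;> rcases h with h | h <;> [left; right; left; right] <;> linarith
  rw [hz, h1]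
  have hd2 : 0 < d ^ 2 := by positivity
  rcases hs with rfl | rfl <;> rcases hfa with ha | ha | ha <;> rcases hfb with hb | hb | hb <;>
    rw [ha, hb] <;> constructor <;> intro hh <;>
    first
    | (exfalso; nlinarith)
    | (exfalso; rcases hh with hh | hh <;> linarith)
    | (left; linarith)
    | (right; linarith)
    | ring1

lemma pow_three {A B C : ℕ} (h : (2:ℤ) ^ A = 2 ^ B + 3 * 2 ^ C) : B = C := by
  have hB : (0:ℤ) < 2 ^ B := by positivity
  have hC : (0:ℤ) < 2 ^ C := by positivity
  rcases lt_trichotomy B C with hlt | heq | hlt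
  · exfalso
    have hA : B < A := (pow_lt_pow_iff_right₀ (by norm_num : (1:ℤ) < 2)).1 (by linarith)
    obtain ⟨e, rfl⟩ := Nat.exists_eq_add_of_lt hlt
    obtain ⟨e', rfl⟩ := Nat.exists_eq_add_of_lt hA
    have h2 : (2:ℤ) ^ B * (2 * 2 ^ e') = 2 ^ B * (1 + 6 * 2 ^ e) := by
      rw [pow_add, pow_add, pow_add, pow_add] at h
      linarith
    have := mul_left_cancel₀ hB.ne' h2
    omega
  · exact heq
  · exfalso
    have hA : C < A := (pow_lt_pow_iff_right₀ (by norm_num : (1:ℤ) < 2)).1 (by linarith)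
    obtain ⟨e, rfl⟩ := Nat.exists_eq_add_of_lt hlt
    obtain ⟨e', rfl⟩ := Nat.exists_eq_add_of_lt hA
    have h2 : (2:ℤ) ^ C * (2 * 2 ^ e') = 2 ^ C * (2 * 2 ^ e + 3) := by
      rw [pow_add, pow_add, pow_add, pow_add] at h
      linarith
    have := mul_left_cancel₀ hC.ne' h2
    omega

lemma pow_ne_three {A C : ℕ} (h : (2:ℤ) ^ A = 3 * 2 ^ C) : False := by
  have hC : (0:ℤ) < 2 ^ C := by positivity
  have hA : C < A := (pow_lt_pow_iff_right₀ (by norm_num : (1:ℤ) < 2)).1 (by linarith)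
  obtain ⟨e', rfl⟩ := Nat.exists_eq_add_of_lt hA
  have h2 : (2:ℤ) ^ C * (2 * 2 ^ e') = 2 ^ C * 3 := by
    rw [pow_add, pow_add] at h
    linarith
  have := mul_left_cancel₀ hC.ne' h2
  omega

lemma De_Tr {f : G v → ℤ} {w : G v} (hw : w ∈ Tr f) : |De f w| = N f := by
  by_cases h : ∃ x, f x ≠ 0
  · obtain ⟨x, hx⟩ := h
    have : De f w = chi w x * N f := by
      unfold De N; rw [mul_sum]
      refine sum_congr rfl fun y _ => ?_
      by_cases hy : f y = 0
      · simp [hy]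
      · rw [hw y x hy hx]; ring
    rw [this, abs_mul, chi_abs, one_mul, abs_of_nonneg (N_nonneg f)]
  · push Not at h
    unfold De N; simp [h]

lemma R_Tr {f : G v → ℤ} (hp : Pl f) {w : G v} (hw : w ∈ Tr f) : R f w = 2 ^ v * N f := by
  obtain ⟨s, hs, hF⟩ := F_add_Tr hw
  rw [← sum_F_sq hp]
  unfold R
  refine sum_congr rfl fun u _ => ?_
  rw [hF]
  rcases hs with rfl | rfl
  · rw [one_mul, abs_mul_self]
  · rw [neg_one_mul, mul_neg, abs_neg, abs_mul_self]

lemma half_pos {f : G v → ℤ} {h : G v} (hh : h ∉ Tr f) {s : ℤ} (hs : Sg s) : 0 < N (hf s h f) := by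
  by_contra hc
  have h0 : N (hf s h f) = 0 := le_antisymm (not_lt.1 hc) (N_nonneg _)
  apply hh
  intro x y hx hy
  rw [Tr_of_half hs h0 x hx, Tr_of_half hs h0 y hy]

lemma exists_sign (f : G v → ℤ) (h : G v) : ∃ s, Sg s ∧ s * De f h = |De f h| := by
  rcases abs_cases (De f h) with ⟨h1, _⟩ | ⟨h1, _⟩
  · exact ⟨1, Or.inl rfl, by rw [h1, one_mul]⟩
  · exact ⟨-1, Or.inr rfl, by rw [h1]; ring⟩

lemma De_bound {f : G v → ℤ} {k : ℕ} (hm : M (k + 1) f) {h : G v} (hh : h ∉ Tr f) :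
    |De f h| ≤ N f - 2 * 2 ^ k := by
  obtain ⟨s, hs, he⟩ := exists_sign f h
  have h1 := N_hf (Sg_neg hs) h f
  have h2 := N_ge (M_hf (Sg_neg hs) h hm) (half_pos hh (Sg_neg hs))
  linarith

section half
variable {f : G v → ℤ} {l : ℕ} (hp : Pl f) (hm : M (l + 3) f)
include hp hm

/-- doubled deficiency of a half -/
lemma H_mod (hl : (2:ℤ) ∣ 10 * 2 ^ l) {s : ℤ} (hs : Sg s) (h : G v) :
    (4:ℤ) ∣ (20 * 2 ^ l - N f) - s * De f h := by
  have h1 := N_hf hs h f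
  have h2 := N_even (M_hf hs h hm)
  omega

lemma H1 (hfl : Flat (l + 3) f) {s : ℤ} (hs : Sg s) {h : G v}
    (hD : 0 < (20 * 2 ^ l - N f) - s * De f h) (hn : 0 < nn (l + 3) f s h) :
    (∃ a : ℕ, nn (l + 3) f s h = 2 ^ a) ∧ ∃ i : ℕ, (20 * 2 ^ l - N f) - s * De f h = 4 * 2 ^ i := by
  have hN := N_hf hs h f
  have e8 : (2:ℤ) ^ (l + 3) = 8 * 2 ^ l := by ring
  have e4 : (4:ℤ) * 2 ^ (l + 1) = 8 * 2 ^ l := by ring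
  have hset : ∀ u, F f u * F f (u + h) = s * (2 ^ (l + 3)) ^ 2 ↔ |F (hf s h f) u| = 8 * 2 ^ l := by
    intro u; rw [nn_iff hfl hs, e8]
  unfold nn at hn ⊢
  simp only [hset] at hn ⊢
  have : (univ.filter fun u => |F (hf s h f) u| = 8 * 2 ^ l).Nonempty :=
    card_pos.1 (by exact_mod_cast hn)
  obtain ⟨u0, hu0⟩ := this
  rw [mem_filter] at hu0
  have hM := M_hf hs h hm
  constructor
  · have := group_lemma (j := l + 1) hM (by rw [pow_succ]; linarith) u0 (by rw [hu0.2, e4])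
    rw [e4] at this; exact this
  · obtain ⟨i, hi⟩ := L2 (Pl_hf h hp) hM (by linarith) u0 hu0.2
    exact ⟨i, by linarith⟩

lemma H2 (hPP : PP v (l + 2)) {s : ℤ} (hs : Sg s) {h : G v}
    (hD : 0 < (20 * 2 ^ l - N f) - s * De f h) (hD' : (20 * 2 ^ l - N f) - s * De f h ≤ 4 * 2 ^ l) :
    GoodD ((20 * 2 ^ l - N f) - s * De f h) := by
  have hN := N_hf hs h f
  have e4 : (2:ℤ) ^ (l + 2) = 4 * 2 ^ l := by ring
  have := hPP (hf s h f) (Pl_hf h hp) (M_hf hs h hm) (by rw [e4]; linarith) (by rw [e4]; linarith)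
  rw [e4] at this
  convert this using 1
  linarith

lemma R_three (hfl : Flat (l + 3) f) {h : G v} {r : ℕ} (hD : |De f h| = 3 * 2 ^ r)
    (hDD : 3 * 2 ^ r < 20 * 2 ^ l - N f) : R f h = 5 * 2 ^ r * 2 ^ v := by
  obtain ⟨s, hs, he⟩ := exists_sign f h
  rw [hD] at he
  have h1 := nn_De' hp hfl hs h
  have h2 := nn_R' hfl hs h
  rw [he] at h1
  have hr : (0:ℤ) < 2 ^ r := by positivity
  have hE : (0:ℤ) < 2 ^ v := by positivity
  have hn0 := nn_nonneg (l + 3) f (-s) h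
  have hpos : 0 < nn (l + 3) f s h := by
    by_contra hc; push Not at hc
    have h5 : 0 < 2 ^ v * (3 * (2:ℤ) ^ r) := by positivity
    rw [← h1] at h5
    have : 0 < nn (l + 3) f s h - nn (l + 3) f (-s) h := pos_of_mul_pos_right h5 (by positivity)
    linarith
  obtain ⟨⟨a, ha⟩, _⟩ := H1 hp hm hfl hs (h := h) (by rw [he]; linarith) hpos
  rcases hn0.eq_or_lt with h0 | h0
  · exfalso
    rw [← h0, ha, sub_zero, ← pow_mul, ← pow_add] at h1
    refine pow_ne_three (C := v + r) (h1.trans ?_)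
    rw [pow_add]; ring
  · obtain ⟨⟨b, hb⟩, _⟩ := H1 hp hm hfl (Sg_neg hs) (h := h) (by rw [neg_mul, he]; linarith) h0
    rw [ha, hb] at h1 h2
    have h3 : (2:ℤ) ^ ((l + 3) * 2 + a) = 2 ^ ((l + 3) * 2 + b) + 3 * 2 ^ (v + r) := by
      rw [pow_add, pow_add, pow_add, pow_mul]; linarith
    have h4 := pow_three h3
    have h5 : ((2:ℤ) ^ (l + 3)) ^ 2 * 2 ^ b = 2 ^ v * 2 ^ r := by
      rw [← pow_mul, ← pow_add, h4, pow_add]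
    linarith

lemma nn_Tr {s : ℤ} {h : G v} (hh : h ∉ Tr f) (hn : 0 < nn (l + 3) f s h) :
    2 * (Nat.card (Tr f) : ℤ) ≤ nn (l + 3) f s h := by
  classical
  unfold nn at hn ⊢
  obtain ⟨u0, hu0⟩ : (univ.filter fun u => F f u * F f (u + h) = s * (2 ^ (l+3)) ^ 2).Nonempty :=
    card_pos.1 (by exact_mod_cast hn)
  rw [mem_filter] at hu0
  set T : Finset (G v) := univ.filter fun w => w ∈ Tr f with hT
  have hc : Nat.card (Tr f) = T.card := by
    rw [Nat.card_eq_fintype_card, Fintype.card_subtype]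
  set A := T.image (fun w => u0 + w) with hA
  set B := T.image (fun w => u0 + h + w) with hB
  have cA : A.card = T.card := card_image_of_injective _ (add_right_injective _)
  have cB : B.card = T.card := card_image_of_injective _ (add_right_injective _)
  have hdis : Disjoint A B := by
    rw [disjoint_left]
    intro x hxA hxB
    rw [hA, mem_image] at hxA
    rw [hB, mem_image] at hxB
    obtain ⟨w, hw, rfl⟩ := hxA
    obtain ⟨w', hw', he⟩ := hxB
    apply hh
    rw [hT, mem_filter] at hw hw'
    rw [add_assoc] at he
    have he' := add_left_cancel he
    have : h = w + w' := by rw [← he', g_add_add]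
    rw [this]
    exact add_mem hw.2 hw'.2
  have hsub : A ∪ B ⊆ univ.filter fun u => F f u * F f (u + h) = s * (2 ^ (l+3)) ^ 2 := by
    intro x hx
    rw [mem_filter]
    refine ⟨mem_univ _, ?_⟩
    rw [mem_union] at hx
    rcases hx with hx | hx
    · rw [hA, mem_image] at hx
      obtain ⟨w, hw, rfl⟩ := hx
      rw [hT, mem_filter] at hw
      obtain ⟨c, hc, hF⟩ := F_add_Tr hw.2
      rw [show u0 + w + h = u0 + h + w by abel, hF, hF, ← hu0.2]
      linear_combination (F f u0 * F f (u0 + h)) * Sg_sq hc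
    · rw [hB, mem_image] at hx
      obtain ⟨w, hw, rfl⟩ := hx
      rw [hT, mem_filter] at hw
      obtain ⟨c, hc, hF⟩ := F_add_Tr hw.2
      rw [show u0 + h + w + h = u0 + (h + h) + w by abel, g_add_self, add_zero, hF, hF, ← hu0.2]
      linear_combination (F f u0 * F f (u0 + h)) * Sg_sq hc
  have := card_le_card hsub
  rw [card_union_of_disjoint hdis, cA, cB] at this
  rw [hc]
  have h2 : ((T.card + T.card : ℕ) : ℤ) ≤ (univ.filter fun u => F f u * F f (u + h) = s * (2 ^ (l+3)) ^ 2).card := by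
    exact_mod_cast this
  push_cast at h2
  linarith

lemma exists_smallR (hfl : Flat (l + 3) f) (hN1 : 16 * 2 ^ l ≤ N f) (hN2 : N f < 20 * 2 ^ l) :
    ∃ h : G v, h ≠ 0 ∧ 4 * R f h < 25 * 2 ^ v := by
  by_contra hc
  push Not at hc
  have htot := flat_sum_R hp hfl
  have hsum : 4 * (2 ^ v * N f) + (2 ^ v - 1) * (25 * 2 ^ v) ≤ 4 * ∑ h, R f h := by
    rw [← Finset.add_sum_erase univ (R f) (mem_univ 0), R_zero hp, mul_add, mul_sum]
    have : ((univ : Finset (G v)).erase 0).card • ((25:ℤ) * 2 ^ v) ≤ ∑ h ∈ univ.erase 0, 4 * R f h :=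
      card_nsmul_le_sum _ _ _ fun h hh => hc h (ne_of_mem_erase hh)
    rw [nsmul_eq_mul, card_erase_of_mem (mem_univ _),
      Nat.cast_sub (card_pos.2 ⟨0, mem_univ _⟩), card_G] at this
    push_cast at this
    linarith
  have hq : (1:ℤ) ≤ 2 ^ l := one_le_pow₀ (by norm_num)
  have hE : (0:ℤ) < 2 ^ v := by positivity
  have e8 : (2:ℤ) ^ (l + 3) = 8 * 2 ^ l := by ring
  rw [e8] at htot
  generalize ∑ h, R f h = Z at *
  generalize N f = n at *
  generalize (2:ℤ) ^ l = q at *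
  generalize (2:ℤ) ^ v = E at *
  have h1 : (8 * q) ^ 2 * (4 * (E * n) + (E - 1) * (25 * E)) ≤ 4 * (E * n) ^ 2 := by
    rw [← htot]
    have := mul_le_mul_of_nonneg_left hsum (by positivity : 0 ≤ (8 * q) ^ 2)
    linarith
  have h2 : n ^ 2 ≤ (20 * q) ^ 2 := by
    apply pow_le_pow_left₀ <;> linarith
  have h3 : E ^ 2 * n ^ 2 ≤ E ^ 2 * (20 * q) ^ 2 := mul_le_mul_of_nonneg_left h2 (by positivity)
  have h4 : (8 * q) ^ 2 * E * (4 * n - 25) ≤ 0 := by linarith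
  have h5 : 0 < (8 * q) ^ 2 * E * (4 * n - 25) := by
    apply mul_pos (by positivity); linarith
  linarith

end half

lemma good_two {i : ℕ} (h : GoodD (4 * 2 ^ i + 4)) : i = 0 ∨ i = 1 := by
  by_contra hc
  push Not at hc
  obtain ⟨y, rfl⟩ : ∃ y, i = y + 2 := ⟨i - 2, by omega⟩
  have hy : (1:ℤ) ≤ 2 ^ y := one_le_pow₀ (by norm_num)
  rw [pow_add] at h
  rcases h with ⟨j, hj⟩ | ⟨j, hj⟩
  · have h1 : 4 < j := (pow_lt_pow_iff_right₀ (by norm_num : (1:ℤ) < 2)).1 (by rw [← hj]; linarith)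
    obtain ⟨e, rfl⟩ := Nat.exists_eq_add_of_lt h1
    rw [pow_add, pow_add] at hj; omega
  · have h1 : 2 < j := (pow_lt_pow_iff_right₀ (by norm_num : (1:ℤ) < 2)).1 (by linarith)
    obtain ⟨e, rfl⟩ := Nat.exists_eq_add_of_lt h1
    rw [pow_add, pow_add] at hj; omega

lemma good_four {i : ℕ} (h : GoodD (4 * 2 ^ i + 8)) : i = 0 ∨ i = 1 ∨ i = 2 := by
  by_contra hc
  push Not at hc
  obtain ⟨y, rfl⟩ : ∃ y, i = y + 3 := ⟨i - 3, by omega⟩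
  have hy : (1:ℤ) ≤ 2 ^ y := one_le_pow₀ (by norm_num)
  rw [pow_add] at h
  rcases h with ⟨j, hj⟩ | ⟨j, hj⟩
  · have h1 : 5 < j := (pow_lt_pow_iff_right₀ (by norm_num : (1:ℤ) < 2)).1 (by rw [← hj]; linarith)
    obtain ⟨e, rfl⟩ := Nat.exists_eq_add_of_lt h1
    rw [pow_add, pow_add] at hj; omega
  · have h1 : 3 < j := (pow_lt_pow_iff_right₀ (by norm_num : (1:ℤ) < 2)).1 (by linarith)
    obtain ⟨e, rfl⟩ := Nat.exists_eq_add_of_lt h1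
    rw [pow_add, pow_add] at hj; omega

lemma pow_small {i : ℕ} {n : ℤ} (h : n = 2 ^ i) (hn : n < 64) :
    n = 1 ∨ n = 2 ∨ n = 4 ∨ n = 8 ∨ n = 16 ∨ n = 32 := by
  have h1 : i < 6 := (pow_lt_pow_iff_right₀ (by norm_num : (1:ℤ) < 2)).1 (by linarith)
  subst h
  interval_cases i <;> norm_num

lemma good_small {n : ℤ} (h : GoodD n) (hn : n < 64) : n ≠ 20 ∧ n ≠ 28 ∧ n ≠ 36 := by
  rcases h with ⟨i, hi⟩ | ⟨i, hi⟩
  · have := pow_small hi hn; omega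
  · have h0 : (0:ℤ) < 2 ^ i := by positivity
    have := pow_small (n := 2 ^ i) rfl (by linarith); omega

lemma L1A {f : G v → ℤ} {l : ℕ} (hp : Pl f) (hm : M (l + 3) f) (hfl : Flat (l + 3) f)
    (hN1 : 16 * 2 ^ l ≤ N f) (hN2 : N f < 20 * 2 ^ l) (hPP : PP v (l + 2)) :
    GoodD (20 * 2 ^ l - N f) ∨
    (20 * 2 ^ l - N f = 10 ∧ (Nat.card (Tr f) : ℤ) * (8 * 2 ^ l) ^ 2 ≤ 2 ^ v) ∨
    (20 * 2 ^ l - N f = 20 ∧ (Nat.card (Tr f) : ℤ) * (8 * 2 ^ l) ^ 2 ≤ 2 * 2 ^ v) := by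
  obtain ⟨h, h0, hR⟩ := exists_smallR hp hm hfl hN1 hN2
  have hE : (0:ℤ) < 2 ^ v := by positivity
  have hq : (1:ℤ) ≤ 2 ^ l := one_le_pow₀ (by norm_num)
  obtain ⟨s, hs, he⟩ := exists_sign f h
  have hRD := R_ge hp h
  have ht6 : |De f h| ≤ 6 := by
    by_contra hc; push Not at hc
    have : 2 ^ v * 7 ≤ (2:ℤ) ^ v * |De f h| := mul_le_mul_of_nonneg_left (by omega) hE.le
    linarith
  have ht0 := abs_nonneg (De f h)
  have hNe := N_even hm
  have hmod := H_mod hp hm (by omega) hs h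
  have hmod' := H_mod hp hm (by omega) (Sg_neg hs) h
  rw [he] at hmod
  rw [neg_mul, he] at hmod'
  have hnD := nn_De' hp hfl hs h
  have hnR := nn_R' hfl hs h
  have h1 := H1 hp hm hfl hs (h := h)
  have h1' := H1 hp hm hfl (Sg_neg hs) (h := h)
  have h2 := H2 hp hm hPP hs (h := h)
  have h2' := H2 hp hm hPP (Sg_neg hs) (h := h)
  have h3 := R_three hp hm hfl (h := h) (r := 1)
  have hn0 := nn_nonneg (l + 3) f (-s) h
  have hn0' := nn_nonneg (l + 3) f s h
  rw [he] at h1 h2 hnD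
  rw [neg_mul, he] at h1' h2'
  have e8 : (2:ℤ) ^ (l + 3) = 8 * 2 ^ l := by ring
  have hTr : h ∉ Tr f := by
    intro hc
    have := De_Tr hc
    linarith
  have hnT := nn_Tr hp hm (s := s) hTr
  have hnpos : 0 < |De f h| → 0 < nn (l + 3) f s h := by
    intro hpos
    have h5 : 0 < 2 ^ v * |De f h| := by positivity
    rw [← hnD] at h5
    have : 0 < nn (l + 3) f s h - nn (l + 3) f (-s) h := pos_of_mul_pos_right h5 (by positivity)
    linarith
  rw [e8] at hnD hnR
  set D := 20 * 2 ^ l - N f with hDdef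
  by_cases hD8 : D < 8
  · left
    have : D = 2 ∨ D = 4 ∨ D = 6 := by omega
    rcases this with h | h | h <;> rw [h]
    · exact Or.inl ⟨1, by norm_num⟩
    · exact Or.inl ⟨2, by norm_num⟩
    · exact Or.inr ⟨1, by norm_num⟩
  have hcases : |De f h| = 0 ∨ |De f h| = 2 ∨ |De f h| = 4 ∨ |De f h| = 6 := by omega
  rcases hcases with ht | ht | ht | ht <;> rw [ht] at h1 h1' h2 h2' hmod hmod' hnD hnpos
  · left
    rw [sub_zero] at h2
    exact h2 (by omega) (by linarith)
  · obtain ⟨⟨a, ha⟩, i, hi⟩ := h1 (by omega) (hnpos (by norm_num))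
    have h5 := h2' (by omega) (by omega)
    rw [show D - -2 = 4 * 2 ^ i + 4 by linarith] at h5
    rcases good_two h5 with rfl | rfl
    · exfalso; norm_num at hi; omega
    · right; left
      norm_num at hi
      refine ⟨by omega, ?_⟩
      have hz : nn (l + 3) f (-s) h = 0 := by
        by_contra hne
        obtain ⟨_, j, hj⟩ := h1' (by omega) (by omega)
        have : (2:ℤ) ^ j = 3 := by omega
        have := pow_small (n := 2 ^ j) rfl (by omega)
        omega
      rw [hz, sub_zero] at hnD
      have h6 := mul_le_mul_of_nonneg_left (hnT (hnpos (by norm_num))) (by positivity : (0:ℤ) ≤ (8 * 2 ^ l) ^ 2)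
      linarith
  · by_cases hbig : D + 4 ≤ 4 * 2 ^ l
    · obtain ⟨⟨a, ha⟩, i, hi⟩ := h1 (by omega) (hnpos (by norm_num))
      have h5 := h2' (by omega) (by omega)
      rw [show D - -4 = 4 * 2 ^ i + 8 by linarith] at h5
      rcases good_four h5 with rfl | rfl | rfl
      · left; norm_num at hi
        exact Or.inl ⟨3, by norm_num; omega⟩
      · left; norm_num at hi
        exact Or.inr ⟨2, by norm_num; omega⟩
      · right; right
        norm_num at hi
        refine ⟨by omega, ?_⟩
        have hz : nn (l + 3) f (-s) h = 0 := by
          by_contra hne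
          obtain ⟨_, j, hj⟩ := h1' (by omega) (by omega)
          have : (2:ℤ) ^ j = 6 := by omega
          have := pow_small (n := 2 ^ j) rfl (by omega)
          omega
        rw [hz, sub_zero] at hnD
        have h6 := mul_le_mul_of_nonneg_left (hnT (hnpos (by norm_num))) (by positivity : (0:ℤ) ≤ (8 * 2 ^ l) ^ 2)
        linarith
    · left; left
      refine ⟨l + 2, ?_⟩
      have : D = 4 * 2 ^ l := by omega
      rw [this]; ring
  · exfalso
    have := h3 (by rw [ht]; norm_num) (by norm_num; omega)
    rw [this] at hR
    norm_num at hR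
    linarith

end TT


namespace TT

open Finset

variable {v : ℕ}

def cs : List (G v) → (G v → ℤ) → ℤ
  | [], w => w 0
  | h :: L, w => cs L w + cs L (fun x => w (x + h))

lemma cs_nonneg (L : List (G v)) : ∀ w : G v → ℤ, (∀ x, 0 ≤ w x) → 0 ≤ cs L w := by
  induction L with
  | nil => intro w hw; exact hw 0
  | cons h L ih => intro w hw; exact add_nonneg (ih _ hw) (ih _ fun x => hw _)

lemma sum_cs (L : List (G v)) : ∀ w : G v → ℤ, ∑ z, cs L (fun x => w (x + z)) = 2 ^ L.length * ∑ x, w x := by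
  induction L with
  | nil => intro w; simp [cs]
  | cons h L ih =>
    intro w
    simp only [cs]
    rw [sum_add_distrib, ih w]
    have := ih (fun x => w (x + h))
    rw [sum_shift h w] at this
    have h2 : ∀ z, cs L (fun x => w (x + h + z)) = cs L (fun x => w (x + z + h)) := by
      intro z; congr 1; funext x; congr 1; abel
    simp only [h2] at *
    rw [this, List.length_cons, pow_succ]; ring

lemma greedy (L : List (G v)) (w : G v → ℤ) (c : ℤ) (h : 2 ^ L.length * ∑ x, w x < (c + 1) * 2 ^ v) :
    ∃ z, cs L (fun x => w (x + z)) ≤ c := by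
  by_contra hc
  push Not at hc
  have h1 : ∑ z : G v, (c + 1) ≤ ∑ z, cs L (fun x => w (x + z)) := sum_le_sum fun z _ => hc z
  rw [sum_cs, sum_const, nsmul_eq_mul, card_G] at h1
  linarith

lemma cs_le_of {c : ℤ} {α β : ℤ} (L : List (G v)) : ∀ w z : G v → ℤ, (∀ x, 0 ≤ w x) →
    (∀ x, w x ≤ c → z x ≤ α + β * w x) → cs L w ≤ c → cs L z ≤ α * 2 ^ L.length + β * cs L w := by
  induction L with
  | nil => intro w z _ h hc; simp only [cs, List.length_nil, pow_zero, mul_one] at *; exact h 0 hc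
  | cons h L ih =>
    intro w z h0 hz hc
    simp only [cs] at *
    have a1 := cs_nonneg L w h0
    have a2 := cs_nonneg L (fun x => w (x + h)) fun x => h0 _
    have b1 := ih w z h0 hz (by linarith)
    have b2 := ih (fun x => w (x + h)) (fun x => z (x + h)) (fun x => h0 _) (fun x => hz _) (by linarith)
    rw [List.length_cons, pow_succ]; linarith

lemma cs_dvd {α β : ℤ} (L : List (G v)) : ∀ w z : G v → ℤ, (∀ x, 0 ≤ w x) →
    (∀ x, w x ≤ 0 → β ∣ z x - α) → cs L w ≤ 0 → β ∣ cs L z - α * 2 ^ L.length := by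
  induction L with
  | nil => intro w z _ h hc; simp only [cs, List.length_nil, pow_zero, mul_one] at *; exact h 0 hc
  | cons h L ih =>
    intro w z h0 hz hc
    simp only [cs] at *
    have a1 := cs_nonneg L w h0
    have a2 := cs_nonneg L (fun x => w (x + h)) fun x => h0 _
    have b1 := ih w z h0 hz (by linarith)
    have b2 := ih (fun x => w (x + h)) (fun x => z (x + h)) (fun x => h0 _) (fun x => hz _) (by linarith)
    rw [List.length_cons, pow_succ]
    obtain ⟨a, ha⟩ := b1
    obtain ⟨b, hb⟩ := b2
    exact ⟨a + b, by linear_combination ha + hb⟩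

lemma cs_add (L : List (G v)) : ∀ w z : G v → ℤ, cs L (fun x => w x + z x) = cs L w + cs L z := by
  induction L with
  | nil => intro w z; rfl
  | cons h L ih =>
    intro w z
    simp only [cs]
    rw [ih w z, ih (fun x => w (x + h)) (fun x => z (x + h))]; ring

lemma De_hf {s : ℤ} (hs : Sg s) (h : G v) (f : G v → ℤ) (x : G v) :
    2 * De (hf s h f) x = De f x + s * De f (x + h) := by
  unfold De
  rw [mul_sum, mul_sum, ← sum_add_distrib]
  refine sum_congr rfl fun y _ => ?_
  rw [← mul_assoc, two_abs_hf hs, chi_add]; ring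

def TT2 (L : List (G v)) (f : G v → ℤ) : ℤ := cs L (fun x => De f x * De f x)

lemma T_step (h : G v) (L : List (G v)) (f : G v → ℤ) :
    TT2 (h :: L) f = 2 * (TT2 L (hf 1 h f) + TT2 L (hf (-1) h f)) := by
  unfold TT2
  simp only [cs]
  rw [← cs_add, ← cs_add, two_mul, ← cs_add]
  congr 1
  funext x
  have h1 := De_hf (Or.inl rfl : Sg 1) h f x
  have h2 := De_hf (Or.inr rfl : Sg (-1)) h f x
  have e1 : De f x = De (hf 1 h f) x + De (hf (-1) h f) x := by linarith
  have e2 : De f (x + h) = De (hf 1 h f) x - De (hf (-1) h f) x := by linarith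
  rw [e1, e2]; ring

lemma ev {A : ℤ} (hA : (2:ℤ) ∣ A) (L : List (G v)) : ∀ f : G v → ℤ, M (L.length + 1) f →
    2 * 2 ^ L.length * (2 ^ L.length * A - N f) ≤
      TT2 L f + (2 ^ L.length) ^ 2 * A ^ 2 - 2 * 2 ^ L.length * A * N f := by
  induction L with
  | nil =>
    intro f hm
    have := N_even hm
    simp only [TT2, cs, List.length_nil, pow_zero, De_zero]
    obtain ⟨a, rfl⟩ := hA
    obtain ⟨b, hb⟩ := this
    rw [hb]
    have h1 : 0 ≤ (a - b) * (a - b - 1) := by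
      rcases le_or_gt (a - b) 0 with h | h
      · exact mul_nonneg_of_nonpos_of_nonpos h (by linarith)
      · exact mul_nonneg h.le (by omega)
    linarith
  | cons h L ih =>
    intro f hm
    rw [T_step]
    have h1 := ih (hf 1 h f) (M_hf (Or.inl rfl) h hm)
    have h2 := ih (hf (-1) h f) (M_hf (Or.inr rfl) h hm)
    have h3 := N_split h f
    rw [List.length_cons, pow_succ, ← h3]
    linarith

lemma par (L : List (G v)) : ∀ f : G v → ℤ, M (L.length + 1) f →
    (2:ℤ) ^ (L.length + 3) ∣ TT2 L f - 2 ^ (L.length + 1) * N f := by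
  induction L with
  | nil =>
    intro f hm
    obtain ⟨b, hb⟩ := N_even hm
    simp only [TT2, cs, List.length_nil, De_zero]
    rw [hb]
    have : (2:ℤ) ∣ b * b - b := by
      rcases Int.even_or_odd' b with ⟨c, rfl | rfl⟩
      · exact ⟨2 * c * c - c, by ring⟩
      · exact ⟨2 * c * c + c, by ring⟩
    obtain ⟨c, hc⟩ := this
    exact ⟨c, by linear_combination 4 * hc⟩
  | cons h L ih =>
    intro f hm
    rw [T_step]
    obtain ⟨a, h1⟩ := ih (hf 1 h f) (M_hf (Or.inl rfl) h hm)
    obtain ⟨b, h2⟩ := ih (hf (-1) h f) (M_hf (Or.inr rfl) h hm)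
    have h3 := N_split h f
    rw [List.length_cons, ← h3]
    refine ⟨a + b, ?_⟩
    rw [pow_succ] at *
    rw [pow_succ _ (L.length + 1 + 2), pow_succ _ (L.length + 1 + 1), pow_succ _ (L.length + 1)]
    rw [pow_succ _ (L.length + 2), pow_succ _ (L.length + 1)] at h1 h2
    linear_combination 2 * h1 + 2 * h2

lemma M_mono {f : G v → ℤ} {j k : ℕ} (h : j ≤ k) (hm : M k f) : M j f :=
  fun u => (pow_dvd_pow 2 h).trans (hm u)

open Classical in
noncomputable def tau (f : G v → ℤ) (h : G v) : ℤ := if h ∈ Tr f then 1 else 0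

open Classical in
lemma sum_tau (f : G v → ℤ) : ∑ h, tau f h = Nat.card (Tr f) := by
  unfold tau
  rw [Nat.card_eq_fintype_card, Fintype.card_subtype, card_filter]
  push_cast; rfl

lemma sumup {f : G v → ℤ} (hp : Pl f) (α C β γ x y : ℤ) (w1 w2 : G v → ℤ)
    (hh : ∀ h, 2 ^ v * (β + γ * (De f h * De f h) + x * w1 h + y * w2 h) ≤ α * R f h + C * 2 ^ v * tau f h) :
    2 ^ v * (β * 2 ^ v + γ * (2 ^ v * N f) + x * ∑ h, w1 h + y * ∑ h, w2 h) ≤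
      α * ∑ h, R f h + C * 2 ^ v * Nat.card (Tr f) := by
  have h1 := sum_le_sum (s := univ) fun h _ => hh h
  rw [← mul_sum, sum_add_distrib, sum_add_distrib, sum_add_distrib, sum_add_distrib, ← mul_sum, ← mul_sum,
    ← mul_sum, ← mul_sum, ← mul_sum, sum_tau, sum_De_sq hp, sum_const, nsmul_eq_mul, card_G] at h1
  linarith

def om (f : G v → ℤ) (h : G v) : ℤ := if |De f h| % 16 = 6 ∨ |De f h| % 16 = 10 then 1 else 0
def ka (f : G v → ℤ) (h : G v) : ℤ := if |De f h| = 2 then 0 else if |De f h| = 6 then 1 else 4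
def kb (f : G v → ℤ) (h : G v) : ℤ := if |De f h| = 4 then 0 else 1

lemma om_nonneg (f : G v → ℤ) (h : G v) : 0 ≤ om f h := by unfold om; split_ifs <;> norm_num
lemma ka_nonneg (f : G v → ℤ) (h : G v) : 0 ≤ ka f h := by unfold ka; split_ifs <;> norm_num
lemma kb_nonneg (f : G v → ℤ) (h : G v) : 0 ≤ kb f h := by unfold kb; split_ifs <;> norm_num

lemma pow_geq {l m : ℕ} (h : (2:ℤ) ^ m < 2 * 2 ^ l) : m ≤ l := by
  have : m < l + 1 := (pow_lt_pow_iff_right₀ (by norm_num : (1:ℤ) < 2)).1 (by rw [pow_succ]; linarith)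
  omega

lemma om_bound {f : G v → ℤ} {y : ℤ} (hm : M 4 f) (hN : N f = 80 * y - 10)
    (h4 : ∀ h, |De f h| % 4 = 2) : 2 ^ v ≤ 4 * ∑ h, om f h := by
  by_contra hc
  push Not at hc
  have hs : 0 ≤ ∑ h, om f h := sum_nonneg fun h _ => om_nonneg f h
  obtain ⟨a, ha⟩ := greedy [] (om f) 0 (by simp only [List.length_nil]; linarith)
  obtain ⟨b, hb⟩ := greedy [a] (om f) 0 (by simp only [List.length_nil, List.length_cons, zero_add, Nat.reduceAdd]; linarith)
  obtain ⟨c, hcc⟩ := greedy [b, a] (om f) 0 (by simp only [List.length_nil, List.length_cons, zero_add, Nat.reduceAdd]; linarith)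
  have hom : ∀ x, om f x ≤ 0 → (64:ℤ) ∣ De f x * De f x - 4 := by
    intro x hx
    have h1 : ¬ (|De f x| % 16 = 6 ∨ |De f x| % 16 = 10) := by
      intro h; unfold om at hx; rw [if_pos h] at hx; norm_num at hx
    have h2 := h4 x
    rw [← abs_mul_abs_self]
    generalize |De f x| = t at *
    have h3 : t % 16 = 2 ∨ t % 16 = 14 := by omega
    rcases h3 with h3 | h3
    · obtain ⟨e, rfl⟩ : ∃ e, t = 16 * e + 2 := ⟨t / 16, by omega⟩
      exact ⟨4 * e * e + e, by ring⟩
    · obtain ⟨e, rfl⟩ : ∃ e, t = 16 * e + 14 := ⟨t / 16, by omega⟩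
      exact ⟨4 * e * e + 7 * e + 3, by ring⟩
  have d1 := cs_dvd [] (fun x => om f (x + a)) (fun x => De f (x + a) * De f (x + a))
    (fun x => om_nonneg f _) (fun x => hom _) ha
  have d2 := cs_dvd [a] (fun x => om f (x + b)) (fun x => De f (x + b) * De f (x + b))
    (fun x => om_nonneg f _) (fun x => hom _) hb
  have d3 := cs_dvd [b, a] (fun x => om f (x + c)) (fun x => De f (x + c) * De f (x + c))
    (fun x => om_nonneg f _) (fun x => hom _) hcc
  have hT : TT2 [c, b, a] f = N f * N f + cs [] (fun x => De f (x + a) * De f (x + a)) +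
      cs [a] (fun x => De f (x + b) * De f (x + b)) + cs [b, a] (fun x => De f (x + c) * De f (x + c)) := by
    rw [← De_zero]; rfl
  have hP := par [c, b, a] f hm
  simp only [List.length_nil, List.length_cons, zero_add, Nat.reduceAdd] at hP d1 d2 d3
  rw [hT, hN] at hP
  norm_num at hP d1 d2 d3
  have hN2 : (80 * y - 10) * (80 * y - 10) = 64 * (100 * (y * y) - 25 * y) + 100 := by ring
  rw [hN2] at hP
  omega

lemma ka_bound {f : G v → ℤ} {y : ℤ} (hm : M 5 f) (hN : N f = 160 * y - 10) :
    2 ^ v ≤ 2 * ∑ h, ka f h := by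
  by_contra hc
  push Not at hc
  have hs : 0 ≤ ∑ h, ka f h := sum_nonneg fun h _ => ka_nonneg f h
  obtain ⟨a, ha⟩ := greedy [] (ka f) 0 (by simp only [List.length_nil]; linarith)
  obtain ⟨b, hb⟩ := greedy [a] (ka f) 0 (by simp only [List.length_nil, List.length_cons, zero_add, Nat.reduceAdd]; linarith)
  obtain ⟨c, hcc⟩ := greedy [b, a] (ka f) 1 (by simp only [List.length_nil, List.length_cons, zero_add, Nat.reduceAdd]; linarith)
  obtain ⟨e, he⟩ := greedy [c, b, a] (ka f) 3 (by simp only [List.length_nil, List.length_cons, zero_add, Nat.reduceAdd]; linarith)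
  have hka : ∀ x, ka f x ≤ 3 → De f x * De f x ≤ 4 + 32 * ka f x := by
    intro x hx
    rw [← abs_mul_abs_self]
    unfold ka at *
    generalize |De f x| = t at *
    split_ifs at * with h1 h2
    · rw [h1]; norm_num
    · rw [h2]; norm_num
    · norm_num at hx
  have d1 := cs_le_of (c := 3) [] (fun x => ka f (x + a)) (fun x => De f (x + a) * De f (x + a))
    (fun x => ka_nonneg f _) (fun x => hka _) (by linarith)
  have d2 := cs_le_of (c := 3) [a] (fun x => ka f (x + b)) (fun x => De f (x + b) * De f (x + b))
    (fun x => ka_nonneg f _) (fun x => hka _) (by linarith)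
  have d3 := cs_le_of (c := 3) [b, a] (fun x => ka f (x + c)) (fun x => De f (x + c) * De f (x + c))
    (fun x => ka_nonneg f _) (fun x => hka _) (by linarith)
  have d4 := cs_le_of (c := 3) [c, b, a] (fun x => ka f (x + e)) (fun x => De f (x + e) * De f (x + e))
    (fun x => ka_nonneg f _) (fun x => hka _) he
  have hT : TT2 [e, c, b, a] f = N f * N f + cs [] (fun x => De f (x + a) * De f (x + a)) +
      cs [a] (fun x => De f (x + b) * De f (x + b)) + cs [b, a] (fun x => De f (x + c) * De f (x + c))
      + cs [c, b, a] (fun x => De f (x + e) * De f (x + e)) := by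
    rw [← De_zero]; rfl
  have hP := ev (A := 10 * y) (by omega) [e, c, b, a] f hm
  simp only [List.length_nil, List.length_cons, zero_add, Nat.reduceAdd] at hP d1 d2 d3 d4
  rw [hT, hN] at hP
  clear hT
  generalize cs [] (fun x => De f (x + a) * De f (x + a)) = X0 at *
  generalize cs [a] (fun x => De f (x + b) * De f (x + b)) = X1 at *
  generalize cs [b, a] (fun x => De f (x + c) * De f (x + c)) = X2 at *
  generalize cs [c, b, a] (fun x => De f (x + e) * De f (x + e)) = X3 at *
  norm_num at hP
  nlinarith

lemma kb_bound {f : G v → ℤ} {y : ℤ} (hm : M 6 f) (hN : N f = 320 * y - 20) :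
    2 ^ v ≤ 16 * ∑ h, kb f h := by
  by_contra hc
  push Not at hc
  have hs : 0 ≤ ∑ h, kb f h := sum_nonneg fun h _ => kb_nonneg f h
  obtain ⟨a, ha⟩ := greedy [] (kb f) 0 (by simp only [List.length_nil]; linarith)
  obtain ⟨b, hb⟩ := greedy [a] (kb f) 0 (by simp only [List.length_nil, List.length_cons, zero_add, Nat.reduceAdd]; linarith)
  obtain ⟨c, hcc⟩ := greedy [b, a] (kb f) 0 (by simp only [List.length_nil, List.length_cons, zero_add, Nat.reduceAdd]; linarith)
  obtain ⟨e, he⟩ := greedy [c, b, a] (kb f) 0 (by simp only [List.length_nil, List.length_cons, zero_add, Nat.reduceAdd]; linarith)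
  obtain ⟨g, hg⟩ := greedy [e, c, b, a] (kb f) 0 (by simp only [List.length_nil, List.length_cons, zero_add, Nat.reduceAdd]; linarith)
  have hkb : ∀ x, kb f x ≤ 0 → De f x * De f x ≤ 16 + 0 * kb f x := by
    intro x hx
    rw [← abs_mul_abs_self]
    unfold kb at *
    generalize |De f x| = t at *
    split_ifs at * with h1
    · rw [h1]; norm_num
    · norm_num at hx
  have d1 := cs_le_of (c := 0) [] (fun x => kb f (x + a)) (fun x => De f (x + a) * De f (x + a))
    (fun x => kb_nonneg f _) (fun x => hkb _) ha
  have d2 := cs_le_of (c := 0) [a] (fun x => kb f (x + b)) (fun x => De f (x + b) * De f (x + b))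
    (fun x => kb_nonneg f _) (fun x => hkb _) hb
  have d3 := cs_le_of (c := 0) [b, a] (fun x => kb f (x + c)) (fun x => De f (x + c) * De f (x + c))
    (fun x => kb_nonneg f _) (fun x => hkb _) hcc
  have d4 := cs_le_of (c := 0) [c, b, a] (fun x => kb f (x + e)) (fun x => De f (x + e) * De f (x + e))
    (fun x => kb_nonneg f _) (fun x => hkb _) he
  have d5 := cs_le_of (c := 0) [e, c, b, a] (fun x => kb f (x + g)) (fun x => De f (x + g) * De f (x + g))
    (fun x => kb_nonneg f _) (fun x => hkb _) hg
  have hT : TT2 [g, e, c, b, a] f = N f * N f + cs [] (fun x => De f (x + a) * De f (x + a)) +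
      cs [a] (fun x => De f (x + b) * De f (x + b)) + cs [b, a] (fun x => De f (x + c) * De f (x + c))
      + cs [c, b, a] (fun x => De f (x + e) * De f (x + e))
      + cs [e, c, b, a] (fun x => De f (x + g) * De f (x + g)) := by
    rw [← De_zero]; rfl
  have hP := ev (A := 10 * y) (by omega) [g, e, c, b, a] f hm
  simp only [List.length_nil, List.length_cons, zero_add, Nat.reduceAdd] at hP d1 d2 d3 d4 d5
  rw [hT, hN] at hP
  clear hT
  generalize cs [] (fun x => De f (x + a) * De f (x + a)) = X0 at *
  generalize cs [a] (fun x => De f (x + b) * De f (x + b)) = X1 at *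
  generalize cs [b, a] (fun x => De f (x + c) * De f (x + c)) = X2 at *
  generalize cs [c, b, a] (fun x => De f (x + e) * De f (x + e)) = X3 at *
  generalize cs [e, c, b, a] (fun x => De f (x + g) * De f (x + g)) = X4 at *
  norm_num at hP
  nlinarith

end TT


namespace TT

open Finset

variable {v : ℕ}

lemma ptw {E α R' r X C τ : ℤ} (hE : 0 ≤ E) (hα : 0 ≤ α) (hR : E * r ≤ R') (hX : X ≤ α * r + C * τ) :
    E * X ≤ α * R' + C * E * τ := by
  have h1 := mul_le_mul_of_nonneg_left hX hE
  have h2 := mul_le_mul_of_nonneg_left hR hα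
  linarith

lemma ar1 {E S Z T : ℤ} (hE : 0 < E) (hZ : 1024 * Z = (E * 70) ^ 2) (hS : E ≤ 4 * S) (hT : T * 1024 ≤ E)
    (h : E * (1228 * E + 13 * (E * 70) + 3872 * S + 0 * S) ≤ 640 * Z + 24000 * E * T) : False := by
  have h1 : 0 ≤ E * (4 * S - E) := mul_nonneg hE.le (by linarith)
  have h2 : 0 ≤ E * (E - T * 1024) := mul_nonneg hE.le (by linarith)
  have h3 : 0 < E * E := mul_pos hE hE
  nlinarith

lemma ar2 {E S K Z T q : ℤ} (hE : 0 < E) (hq : 8 ≤ q) (hZ : 64 * q ^ 2 * Z = (E * (20 * q - 10)) ^ 2)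
    (hS : E ≤ 4 * S) (hK : E ≤ 2 * K) (hT : T * (64 * q ^ 2) ≤ E) (hT0 : 0 ≤ T)
    (h : E * ((80 * q - 12) * E + 3 * (E * (20 * q - 10)) + (120 * q - 200) * K + (200 * q - 100) * S)
      ≤ 40 * q * Z + (400 * q ^ 2 - 40 * q - 612) * E * T) : False := by
  have h1 : 0 ≤ (200 * q - 100) * (4 * S - E) := mul_nonneg (by linarith) (by linarith)
  have h2 : 0 ≤ (120 * q - 200) * (2 * K - E) := mul_nonneg (by linarith) (by linarith)
  have h3 : 4 * ((400 * q ^ 2 - 40 * q - 612) * T) ≤ 25 * E := by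
    have : 0 ≤ T * (40 * q + 612) := mul_nonneg hT0 (by linarith)
    linarith
  have h4 : 4 * (250 * q - 167) * E ≤ 4 * ((80 * q - 12) * E + 3 * (E * (20 * q - 10)) + (120 * q - 200) * K + (200 * q - 100) * S) := by
    linarith
  have h5 := mul_le_mul_of_nonneg_left h4 hE.le
  have h6 := mul_le_mul_of_nonneg_left h3 hE.le
  have h7 : E * (4 * (250 * q - 167) * E) ≤ 160 * q * Z + 25 * E * E := by linarith
  have h8 := mul_le_mul_of_nonneg_left h7 (by linarith : 0 ≤ 2 * q)
  have h9 : 0 < E * E * (614 * q - 500) := mul_pos (mul_pos hE hE) (by linarith)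
  linarith

lemma ar3 {E Z T : ℤ} (hE : 0 < E) (hZ : 4096 * Z = (E * 140) ^ 2) (hT : T * 4096 ≤ 2 * E)
    (h : E * (304 * E + 1 * (E * 140) + 0 * T + 0 * T) ≤ 80 * Z + 8704 * E * T) : False := by
  have h2 : 0 ≤ E * (2 * E - T * 4096) := mul_nonneg hE.le (by linarith)
  have h3 : 0 < E * E := mul_pos hE hE
  nlinarith

lemma ar4 {E K Z T q : ℤ} (hE : 0 < E) (hq : 16 ≤ q) (hZ : 64 * q ^ 2 * Z = (E * (20 * q - 20)) ^ 2)
    (hK : E ≤ 16 * K) (hT : T * (64 * q ^ 2) ≤ 2 * E) (hT0 : 0 ≤ T)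
    (h : E * ((256 * q - 80) * E + 5 * (E * (20 * q - 20)) + (768 * q) * K + 0 * K)
      ≤ 64 * q * Z + (720 * q ^ 2 - 1696 * q + 1920) * E * T) : False := by
  have h1 : 0 ≤ (768 * q) * (16 * K - E) := mul_nonneg (by linarith) (by linarith)
  have h3 : 2 * ((720 * q ^ 2 - 1696 * q + 1920) * T) ≤ 45 * E := by
    have : 0 ≤ T * (1696 * q - 1920) := mul_nonneg hT0 (by linarith)
    linarith
  have h4 : 2 * (404 * q - 180) * E ≤ 2 * ((256 * q - 80) * E + 5 * (E * (20 * q - 20)) + (768 * q) * K + 0 * K) := by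
    linarith
  have h5 := mul_le_mul_of_nonneg_left h4 hE.le
  have h6 := mul_le_mul_of_nonneg_left h3 hE.le
  have h7 : E * (2 * (404 * q - 180) * E) ≤ 128 * q * Z + 45 * E * E := by linarith
  have h8 := mul_le_mul_of_nonneg_left h7 (by linarith : 0 ≤ q)
  have h9 : 0 < E * E * (8 * q ^ 2 + 1195 * q - 800) := mul_pos (mul_pos hE hE) (by nlinarith)
  linarith

lemma tau_pos {f : G v → ℤ} {h : G v} (hh : h ∈ Tr f) : tau f h = 1 := by unfold tau; rw [if_pos hh]
lemma tau_neg {f : G v → ℤ} {h : G v} (hh : h ∉ Tr f) : tau f h = 0 := by unfold tau; rw [if_neg hh]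

lemma om_val (f : G v → ℤ) (h : G v) : (om f h = 1 ∧ (|De f h| % 16 = 6 ∨ |De f h| % 16 = 10)) ∨
    (om f h = 0 ∧ ¬ (|De f h| % 16 = 6 ∨ |De f h| % 16 = 10)) := by
  unfold om; split_ifs with h1
  · exact Or.inl ⟨rfl, h1⟩
  · exact Or.inr ⟨rfl, h1⟩

lemma q_cases {l : ℕ} (j : ℕ) (h : (2:ℤ) ^ j < 2 * 2 ^ l) : ∃ m, l = m + j :=
  ⟨l - j, by have := pow_geq h; omega⟩

lemma ex10 {f : G v → ℤ} {l : ℕ} (hp : Pl f) (hm : M (l + 3) f) (hfl : Flat (l + 3) f)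
    (h16 : 16 * 2 ^ l ≤ N f) (hPP : PP v (l + 2)) (hD : 20 * 2 ^ l - N f = 10)
    (hT : (Nat.card (Tr f) : ℤ) * (8 * 2 ^ l) ^ 2 ≤ 2 ^ v) : False := by
  have hE : (0:ℤ) < 2 ^ v := by positivity
  have hl : (2:ℤ) ^ 2 ≤ 2 ^ l := by
    obtain ⟨m, rfl⟩ := q_cases (l := l) 2 (by linarith)
    exact pow_le_pow_right₀ (by norm_num) (by omega)
  obtain ⟨m, rfl⟩ := q_cases (l := l) 2 (by linarith)
  have hZ := flat_sum_R hp hfl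
  have h5 : ∀ h, |De f h| % 4 = 2 := by
    intro h
    obtain ⟨s, hs, hse⟩ := exists_sign f h
    have := H_mod hp hm (by omega) hs h
    rw [hD, hse] at this
    omega
  have hq4 : (2:ℤ) ^ (m + 2) = 4 * 2 ^ m := by rw [pow_add]; ring
  have hom := om_bound (y := 2 ^ m) (M_mono (by omega) hm) (by linarith) h5
  have hb : ∀ h, h ∉ Tr f → |De f h| ≤ 12 * 2 ^ (m + 2) - 10 := by
    intro h hh
    have := De_bound (k := m + 2 + 2) hm hh
    rw [pow_add _ (m + 2) 2] at this
    linarith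
  have h6 : ∀ h, |De f h| = 6 → R f h = 2 ^ v * 10 := by
    intro h hh
    rw [R_three hp hm hfl (r := 1) (by rw [hh]; norm_num) (by rw [hD]; norm_num)]; ring
  rw [pow_add _ (m + 2) 3] at hZ
  rcases Nat.eq_zero_or_pos m with rfl | hmp
  · norm_num at hD hT hZ hb
    have hN : N f = 70 := by linarith
    refine ar1 (S := ∑ h, om f h) (Z := ∑ h, R f h) (T := Nat.card (Tr f)) hE ?_ hom ?_ ?_
    · rw [← hN, ← hZ]
    · simpa using hT
    rw [← hN]
    refine sumup hp 640 24000 1228 13 3872 0 (om f) (om f) fun h => ?_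
    have ho := om_val f h
    have hRg := R_ge hp h
    have h5' := h5 h
    rw [← abs_mul_abs_self]
    by_cases hh : h ∈ Tr f
    · rw [tau_pos hh]
      refine ptw hE.le (by norm_num) hRg ?_
      rw [De_Tr hh, hN] at *
      omega
    · rw [tau_neg hh]
      have hb' := hb h hh
      have h6' := h6 h
      have h0 := abs_nonneg (De f h)
      by_cases ht6 : |De f h| = 6
      · refine ptw (r := 10) hE.le (by norm_num) (h6' ht6).ge ?_
        rw [ht6] at ho ⊢
        omega
      · refine ptw hE.le (by norm_num) hRg ?_
        generalize |De f h| = t at *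
        have : t ≤ 38 := by linarith
        interval_cases t <;> omega
  · obtain ⟨n, rfl⟩ : ∃ n, m = n + 1 := ⟨m - 1, by omega⟩
    have hq8 : (2:ℤ) ^ (n + 1 + 2) = 8 * 2 ^ n := by rw [pow_add, pow_add]; ring
    have hn : (1:ℤ) ≤ 2 ^ n := one_le_pow₀ (by norm_num)
    have hka := ka_bound (y := 2 ^ n) (M_mono (by omega) hm) (by linarith)
    have h10 : ∀ h, |De f h| ≠ 10 := by
      intro h hh
      obtain ⟨s, hs, hse⟩ := exists_sign f h
      rw [hh] at hse
      have e : 20 * 2 ^ (n + 1 + 2) - N f - -s * De f h = 20 := by linarith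
      have := H2 hp hm hPP (Sg_neg hs) (h := h) (by rw [e]; norm_num) (by rw [e]; linarith)
      rw [e] at this
      exact (good_small this (by norm_num)).1 rfl
    generalize (2:ℤ) ^ (n + 1 + 2) = q at *
    have hN : N f = 20 * q - 10 := by linarith
    have hq : 8 ≤ q := by linarith
    refine ar2 (S := ∑ h, om f h) (K := ∑ h, ka f h) (Z := ∑ h, R f h) (T := Nat.card (Tr f)) (q := q) hE hq
      ?_ hom hka ?_ (by positivity) ?_
    · rw [← hN, ← hZ]; ring
    · linarith
    rw [← hN]
    refine sumup hp (40 * q) _ (80 * q - 12) 3 (120 * q - 200) (200 * q - 100) (ka f) (om f) fun h => ?_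
    have ho := om_val f h
    have hRg := R_ge hp h
    have h5' := h5 h
    have hk : ka f h = if |De f h| = 2 then 0 else if |De f h| = 6 then 1 else 4 := rfl
    rw [← abs_mul_abs_self]
    by_cases hh : h ∈ Tr f
    · rw [tau_pos hh]
      refine ptw hE.le (by linarith) hRg ?_
      rw [De_Tr hh, hN] at *
      rw [if_neg (by omega), if_neg (by omega)] at hk
      rw [hk]
      rcases ho with ⟨ho, -⟩ | ⟨ho, -⟩ <;> rw [ho] <;> nlinarith
    · rw [tau_neg hh]
      have hb' := hb h hh
      have h0 := abs_nonneg (De f h)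
      have h10' := h10 h
      by_cases ht6 : |De f h| = 6
      · refine ptw (r := 10) hE.le (by linarith) (h6 h ht6).ge ?_
        rw [ht6] at hk
        try rw [ht6] at ho
        rw [ht6, hk]
        rcases ho with ⟨ho, ho2⟩ | ⟨ho, ho2⟩ 
        · rw [ho]; norm_num; linarith
        · omega
      · refine ptw hE.le (by linarith) hRg ?_
        rw [if_neg ht6] at hk
        generalize |De f h| = t at *
        by_cases ht2 : t = 2
        · subst ht2
          rcases ho with ⟨ho, ho2⟩ | ⟨ho, ho2⟩
          · omega
          · rw [hk, ho]; norm_num; linarith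
        · rw [if_neg ht2] at hk
          rcases ho with ⟨ho, ho2⟩ | ⟨ho, ho2⟩
          · have h22 : 22 ≤ t := by omega
            rw [hk, ho]
            have a1 : 0 ≤ (t - 22) * (12 * q - 10 - t) := mul_nonneg (by linarith) (by linarith)
            have a2 : 0 ≤ (q - 8) * (t - 22) := mul_nonneg (by linarith) (by linarith)
            linarith
          · have h14 : 14 ≤ t := by omega
            rw [hk, ho]
            have a1 : 0 ≤ (t - 14) * (12 * q - 10 - t) := mul_nonneg (by linarith) (by linarith)
            have a2 : 0 ≤ (q - 8) * (t - 14) := mul_nonneg (by linarith) (by linarith)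
            linarith

lemma ex20 {f : G v → ℤ} {l : ℕ} (hp : Pl f) (hm : M (l + 3) f) (hfl : Flat (l + 3) f)
    (h16 : 16 * 2 ^ l ≤ N f) (hPP : PP v (l + 2)) (hD : 20 * 2 ^ l - N f = 20)
    (hT : (Nat.card (Tr f) : ℤ) * (8 * 2 ^ l) ^ 2 ≤ 2 * 2 ^ v) : False := by
  have hE : (0:ℤ) < 2 ^ v := by positivity
  obtain ⟨m, rfl⟩ := q_cases (l := l) 3 (by linarith)
  have hZ := flat_sum_R hp hfl
  have hq8 : (2:ℤ) ^ (m + 3) = 8 * 2 ^ m := by rw [pow_add]; ring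
  have hn : (1:ℤ) ≤ 2 ^ m := one_le_pow₀ (by norm_num)
  have h5 : ∀ h, |De f h| % 4 = 0 := by
    intro h
    obtain ⟨s, hs, hse⟩ := exists_sign f h
    have := H_mod hp hm (by omega) hs h
    rw [hD, hse] at this
    omega
  have h00 : ∀ h t, |De f h| = t → 20 + t ≤ 4 * 2 ^ (m + 3) → GoodD (20 + t) := by
    intro h t hh ht
    have := abs_nonneg (De f h)
    obtain ⟨s, hs, hse⟩ := exists_sign f h
    rw [hh] at hse
    have e : 20 * 2 ^ (m + 3) - N f - -s * De f h = 20 + t := by linarith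
    have := H2 hp hm hPP (Sg_neg hs) (h := h) (by rw [e]; linarith) (by rw [e]; linarith)
    rwa [e] at this
  have hn0 : ∀ h, |De f h| ≠ 0 := fun h hh =>
    (good_small (h00 h 0 hh (by linarith)) (by norm_num)).1 rfl
  have hn8 : ∀ h, |De f h| ≠ 8 := fun h hh =>
    (good_small (h00 h 8 hh (by linarith)) (by norm_num)).2.1 rfl
  have hb : ∀ h, h ∉ Tr f → |De f h| ≤ 12 * 2 ^ (m + 3) - 20 := by
    intro h hh
    have := De_bound (k := m + 3 + 2) hm hh
    rw [pow_add _ (m + 3) 2] at this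
    linarith
  have h6 : ∀ h, |De f h| = 12 → R f h = 2 ^ v * 20 := by
    intro h hh
    rw [R_three hp hm hfl (r := 2) (by rw [hh]; norm_num) (by rw [hD]; norm_num)]; ring
  rw [pow_add _ (m + 3) 3] at hZ
  rcases Nat.eq_zero_or_pos m with rfl | hmp
  · have hN : N f = 140 := by norm_num at hD; linarith
    refine ar3 (Z := ∑ h, R f h) (T := Nat.card (Tr f)) hE ?_ ?_ ?_
    · rw [← hN, ← hZ]; norm_num
    · norm_num at hT; simpa using hT
    have := sumup hp 80 8704 304 1 0 0 (om f) (om f) fun h => ?_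
    · rw [hN] at this; linarith
    have hRg := R_ge hp h
    have h5' := h5 h
    have h0' := hn0 h
    have h0 := abs_nonneg (De f h)
    rw [← abs_mul_abs_self]
    by_cases hh : h ∈ Tr f
    · rw [tau_pos hh]
      refine ptw hE.le (by norm_num) hRg ?_
      rw [De_Tr hh, hN]
      norm_num
    · rw [tau_neg hh]
      have hb' := hb h hh
      norm_num at hb'
      refine ptw hE.le (by norm_num) hRg ?_
      generalize |De f h| = t at *
      have : 4 ≤ t := by omega
      nlinarith
  · obtain ⟨n, rfl⟩ : ∃ n, m = n + 1 := ⟨m - 1, by omega⟩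
    have hq16 : (2:ℤ) ^ (n + 1 + 3) = 16 * 2 ^ n := by rw [pow_add, pow_add]; ring
    have hn : (1:ℤ) ≤ 2 ^ n := one_le_pow₀ (by norm_num)
    have hkb := kb_bound (y := 2 ^ n) (M_mono (by omega) hm) (by linarith)
    have hn16 : ∀ h, |De f h| ≠ 16 := fun h hh =>
      (good_small (h00 h 16 hh (by linarith)) (by norm_num)).2.2 rfl
    generalize (2:ℤ) ^ (n + 1 + 3) = q at *
    have hN : N f = 20 * q - 20 := by linarith
    have hq : 16 ≤ q := by linarith
    refine ar4 (K := ∑ h, kb f h) (Z := ∑ h, R f h) (T := Nat.card (Tr f)) (q := q) hE hq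
      ?_ hkb ?_ (by positivity) ?_
    · rw [← hN, ← hZ]; ring
    · linarith
    rw [← hN]
    refine sumup hp (64 * q) _ (256 * q - 80) 5 (768 * q) 0 (kb f) (kb f) fun h => ?_
    have hRg := R_ge hp h
    have h5' := h5 h
    have h0' := hn0 h
    have h8' := hn8 h
    have h16' := hn16 h
    have h0 := abs_nonneg (De f h)
    have hk : kb f h = if |De f h| = 4 then 0 else 1 := rfl
    rw [← abs_mul_abs_self]
    by_cases hh : h ∈ Tr f
    · rw [tau_pos hh]
      refine ptw hE.le (by linarith) hRg ?_
      rw [De_Tr hh, hN] at *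
      rw [if_neg (by omega)] at hk
      rw [hk]
      nlinarith
    · rw [tau_neg hh]
      have hb' := hb h hh
      by_cases ht6 : |De f h| = 12
      · refine ptw (r := 20) hE.le (by linarith) (h6 h ht6).ge ?_
        rw [ht6] at hk
        try rw [ht6] at ho
        rw [ht6, hk]
        norm_num; linarith
      · refine ptw hE.le (by linarith) hRg ?_
        generalize |De f h| = t at *
        by_cases ht2 : t = 4
        · subst ht2
          rw [hk]; norm_num; linarith
        · rw [if_neg ht2] at hk
          have h22 : 20 ≤ t := by omega
          rw [hk]
          have a1 : 0 ≤ (t - 20) * (12 * q - 20 - t) := mul_nonneg (by linarith) (by linarith)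
          nlinarith

end TT


namespace TT

open Finset

variable {v : ℕ}

theorem PP_all : ∀ k, PP v k
  | 0 => by
    intro f hp hm h1 h2
    norm_num at h1 h2 ⊢
    have : N f = 2 := by omega
    exact Or.inl ⟨0, by rw [this]; norm_num⟩
  | 1 => by
    intro f hp hm h1 h2
    have he := N_even (k := 0) hm
    norm_num at h1 h2 ⊢
    have : N f = 4 := by omega
    exact Or.inl ⟨1, by rw [this]; norm_num⟩
  | 2 => by
    intro f hp hm h1 h2
    have he := N_even (k := 1) hm
    norm_num at h1 h2 ⊢
    have : N f = 8 := by omega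
    exact Or.inl ⟨2, by rw [this]; norm_num⟩
  | l + 3 => by
    have ih : PP v (l + 2) := PP_all (l + 2)
    intro f hp hm h1 h2
    have hq : (2:ℤ) ^ (l + 3) = 8 * 2 ^ l := by rw [pow_add]; ring
    by_cases hu : ∀ u, |F f u| < 2 * 2 ^ (l + 3)
    · have hfl := flat_of_lt hm hu
      have hD : GoodD (20 * 2 ^ l - N f) := by
        rcases L1A hp hm hfl (by linarith) (by linarith) ih with h | ⟨h, h'⟩ | ⟨h, h'⟩
        · exact h
        · exact (ex10 hp hm hfl (by linarith) ih h h').elim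
        · exact (ex20 hp hm hfl (by linarith) ih h h').elim
      rcases hD with ⟨i, hi⟩ | ⟨i, hi⟩
      · exact Or.inl ⟨i + 1, by rw [hq, pow_succ]; linarith⟩
      · exact Or.inr ⟨i + 1, by rw [hq, pow_succ]; linarith⟩
    · push Not at hu
      obtain ⟨u, hu⟩ := hu
      have h3 := F_le f u
      have h4 : (2:ℤ) ^ (l + 3) ∣ |F f u| := (dvd_abs _ _).2 (hm u)
      obtain ⟨c, hc⟩ := h4
      have hpos : (0:ℤ) < 2 ^ l := by positivity
      have hc2 : c = 2 := by
        rw [hc, hq] at hu h3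
        have a1 : c < 3 := by
          by_contra hcc
          push Not at hcc
          nlinarith
        have a2 : 1 < c := by
          by_contra hcc
          push Not at hcc
          nlinarith
        omega
      have h2l : (2:ℤ) ^ (l + 1) = 2 * 2 ^ l := by rw [pow_add]; ring
      obtain ⟨i, hi⟩ := L2 (k := l + 1) hp hm (by linarith) u (by rw [hc, hc2]; linarith)
      exact Or.inl ⟨i + 2, by rw [hq, pow_add]; linarith⟩

lemma sg_sum {ι : Type*} (s : Finset ι) (g : ι → ZMod 2) : sg (∑ i ∈ s, g i) = ∏ i ∈ s, sg (g i) := by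
  classical
  induction s using Finset.induction_on with
  | empty => simp [sg]
  | insert a s ha ih => rw [sum_insert ha, prod_insert ha, ← ih, sg_add]

lemma chi_expand (u x : G v) : chi u x = ∑ S ∈ (univ.filter fun j => u j = 1).powerset,
    (-2) ^ S.card * (if ∀ j ∈ S, x j = 1 then 1 else 0) := by
  have h1 : chi u x = ∏ j ∈ univ.filter (fun j => u j = 1), (1 + (if x j = 1 then (-2:ℤ) else 0)) := by
    unfold chi dotProduct
    rw [sg_sum, prod_filter]
    refine prod_congr rfl fun j _ => ?_
    generalize u j = a
    generalize x j = b
    revert a b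
    decide
  rw [h1, prod_one_add]
  refine sum_congr rfl fun S _ => ?_
  rw [prod_ite_zero]
  split_ifs <;> simp

def ft (T0 T1 : Finset (G v)) (x : G v) : ℤ := (if x ∈ T0 then 1 else 0) - (if x ∈ T1 then 1 else 0)

lemma ft_Pl (T0 T1 : Finset (G v)) : Pl (ft T0 T1) := by
  intro x; unfold ft; split_ifs <;> simp

lemma ft_N {T0 T1 : Finset (G v)} (h : Disjoint T0 T1) : N (ft T0 T1) = T0.card + T1.card := by
  have : ∀ x, |ft T0 T1 x| = (if x ∈ T0 then 1 else 0) + (if x ∈ T1 then 1 else 0) := by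
    intro x
    have := fun ha : x ∈ T0 => Finset.disjoint_left.1 h ha
    unfold ft
    split_ifs with h1 h2 <;> simp_all
  unfold N
  simp only [this, sum_add_distrib, sum_ite_mem, univ_inter, sum_const]
  simp

lemma ft_M {t : ℕ} {T0 T1 : Finset (G v)} (h : IsTrade t v T0 T1) : M (t + 1) (ft T0 T1) := by
  intro u
  unfold F
  simp only [chi_expand, mul_sum]
  rw [sum_comm]
  refine dvd_sum fun S _ => ?_
  by_cases hS : S.card ≤ t
  · have hs := h.2 (fun j => if j ∈ S then 1 else 0) (by
      unfold size
      simpa using hS)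
    have e : ∑ x, ft T0 T1 x * ((-2) ^ S.card * (if ∀ j ∈ S, x j = 1 then 1 else 0)) = 0 := by
      have : ∀ x, ft T0 T1 x * ((-2) ^ S.card * (if ∀ j ∈ S, x j = 1 then 1 else 0)) =
        (-2) ^ S.card * ((if x ∈ T0 then (if ∀ j ∈ S, x j = 1 then 1 else 0) else 0) -
          (if x ∈ T1 then (if ∀ j ∈ S, x j = 1 then 1 else 0) else 0)) := by
        intro x; unfold ft; split_ifs <;> ring
      simp only [this]
      rw [← mul_sum, sum_sub_distrib, sum_ite_mem, sum_ite_mem, univ_inter, univ_inter]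
      simp only [← sum_filter, sum_const]
      have e2 : ∀ x : G v, (∀ j, (if j ∈ S then (1 : ZMod 2) else 0) = 1 → x j = 1) ↔ ∀ j ∈ S, x j = 1 := by
        intro x; simp
      simp only [e2] at hs
      rw [hs]; simp
    rw [e]; exact dvd_zero _
  · refine dvd_sum fun x _ => ?_
    have : (2:ℤ) ^ (t + 1) ∣ (-2) ^ S.card :=
      (pow_dvd_pow 2 (by omega)).trans (pow_dvd_pow_of_dvd (by norm_num) _)
    exact Dvd.dvd.mul_left (Dvd.dvd.mul_right this _) _

end TT

/-- main theorem: the volume of a `[t]`-trade that is less than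
`2^(t+1) + 2^(t-1)` has one of the four listed forms. -/
theorem tTrade_volume_forms (v t : ℕ) (T0 T1 : Finset (Fin v → ZMod 2))
    (h : IsTrade t v T0 T1)
    (hvol : T0.card < 2 ^ (t + 1) + 2 ^ (t - 1)) :
    (∃ i, i ≤ t + 1 ∧ T0.card = 2 ^ (t + 1) - 2 ^ i) ∨
    (∃ i, (t - 1 + 1) / 2 ≤ i ∧ i ≤ t - 2 ∧ T0.card = 2 ^ (t + 1) + 2 ^ i) ∨
    (∃ i, i ≤ t - 1 ∧ T0.card = 2 ^ (t + 1) + 2 ^ (t - 1) - 2 ^ i) ∨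
    (∃ i, i ≤ t - 3 ∧ T0.card = 2 ^ (t + 1) + 2 ^ (t - 1) - 3 * 2 ^ i) := by
  have hc : T0.card = T1.card := by
    have := h.2 (fun _ => 0) (by simp [size])
    simpa using this
  have hN := TT.ft_N h.1
  rw [← hc] at hN
  have hM := TT.ft_M h
  have hp := TT.ft_Pl T0 T1
  generalize TT.ft T0 T1 = f at *
  generalize T0.card = c at *
  rcases t with _ | n
  · norm_num at hvol
    interval_cases c
    · exact Or.inl ⟨1, by norm_num⟩
    · exact Or.inl ⟨0, by norm_num⟩
    · exact Or.inr (Or.inr (Or.inl ⟨0, by norm_num⟩))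
  simp only [Nat.add_sub_cancel] at *
  have hb : 2 ^ (n + 1 + 1) = 4 * 2 ^ n := by rw [pow_add, pow_add]; ring
  have hbz : (2:ℤ) ^ (n + 1 + 1) = 4 * 2 ^ n := by rw [pow_add, pow_add]; ring
  have hpos : 0 < 2 ^ n := by positivity
  have hcast : ((2 ^ n : ℕ) : ℤ) = 2 ^ n := by push_cast; rfl
  rcases Nat.eq_zero_or_pos c with rfl | hc0
  · exact Or.inl ⟨n + 1 + 1, by simp⟩
  rcases lt_or_ge c (4 * 2 ^ n) with hlt | hge
  · obtain ⟨i, hi⟩ := TT.L0 _ f hp hM (by rw [hN]; omega) (by rw [hN, hbz]; omega)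
    rw [hN, hbz, ← hcast] at hi
    rcases i with _ | i
    · rw [pow_zero] at hi; omega
    have hi' : c + 2 ^ i = 4 * 2 ^ n := by
      rw [pow_succ] at hi
      have : ((2 ^ i : ℕ) : ℤ) = 2 ^ i := by push_cast; rfl
      omega
    left
    refine ⟨i, ?_, by omega⟩
    exact (pow_le_pow_iff_right₀ (by norm_num : 1 < 2)).1 (by omega)
  · have hG := TT.PP_all (n + 1 + 1) f hp hM (by rw [hN, hbz]; omega) (by rw [hN, hbz]; omega)
    rw [hN, hbz, ← hcast] at hG
    right; right
    rcases hG with ⟨i, hi⟩ | ⟨i, hi⟩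
    · rcases i with _ | _ | i
      · rw [pow_zero] at hi; omega
      · norm_num at hi; omega
      have hi' : c + 2 ^ i = 5 * 2 ^ n := by
        rw [pow_succ, pow_succ] at hi
        have : ((2 ^ i : ℕ) : ℤ) = 2 ^ i := by push_cast; rfl
        omega
      left
      refine ⟨i, ?_, by omega⟩
      exact (pow_le_pow_iff_right₀ (by norm_num : 1 < 2)).1 (by omega)
    · rcases i with _ | _ | i
      · rw [pow_zero] at hi; omega
      · norm_num at hi; omega
      have hi' : c + 3 * 2 ^ i = 5 * 2 ^ n := by
        rw [pow_succ, pow_succ] at hi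
        have : ((2 ^ i : ℕ) : ℤ) = 2 ^ i := by push_cast; rfl
        omega
      right
      refine ⟨i, ?_, by omega⟩
      have hi1 : 0 < 2 ^ i := by positivity
      have : i + 1 < n := (pow_lt_pow_iff_right₀ (by norm_num : 1 < 2)).1 (by rw [pow_succ]; omega)
      omega
end

section
/- Every [t]-trade of volume less than 2^{t+1} has volume equal to 2^{t+1} − 2^i for some i ∈ {0,…,t+1}. In particular, for every i from 2 to t, there is no [t]-trade of volume strictly greater than 2^{t+1} − 2^i and strictly less than 2^{t+1} − 2^{i−1}. -/
set_option linter.unusedSectionVars false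
/-- A perfect symmetric sign pairing on an elementary abelian 2-group. -/
structure SignPairing (V : Type) [AddCommGroup V] [Fintype V] [DecidableEq V]
    (χ : V → V → ℤ) (m : ℕ) : Prop where
  symm : ∀ x y, χ x y = χ y x
  add : ∀ x y s, χ (x + y) s = χ x s * χ y s
  pm : ∀ x s, χ x s = 1 ∨ χ x s = -1
  self : ∀ x : V, x + x = 0
  orth : ∀ x, ∑ s, χ x s = if x = 0 then 2 ^ m else 0
  card : Fintype.card V = 2 ^ m

section
variable {V : Type} [AddCommGroup V] [Fintype V] [DecidableEq V]

def hatT (χ : V → V → ℤ) (f : V → ℤ) (x : V) : ℤ := ∑ s, f s * χ x s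

def convT (f g : V → ℤ) (w : V) : ℤ := ∑ y, f y * g (y + w)

def IsTern (f : V → ℤ) : Prop := ∀ x, f x = 0 ∨ f x = 1 ∨ f x = -1

def stabT (f : V → ℤ) : Finset V := Finset.univ.filter (fun v => ∀ x, (f (x + v)) ^ 2 = (f x) ^ 2)

variable {χ : V → V → ℤ} {m : ℕ}

lemma hat_hat (P : SignPairing V χ m) (f : V → ℤ) (y : V) :
    hatT χ (hatT χ f) y = 2 ^ m * f y := by
  unfold hatT
  simp_rw [Finset.sum_mul]
  rw [Finset.sum_comm]
  have : ∀ s, ∑ x, f s * χ x s * χ y x = f s * (if s = y then 2 ^ m else 0) := by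
    intro s
    have h1 : ∀ x, f s * χ x s * χ y x = f s * χ (s + y) x := by
      intro x; rw [P.add, P.symm x s]; ring
    simp_rw [h1, ← Finset.mul_sum, P.orth]
    congr 1
    have : s + y = 0 ↔ s = y := by
      constructor
      · intro h
        have := P.self y
        have h2 : s + y = y + y := by rw [h, this]
        exact add_right_cancel h2
      · rintro rfl; exact P.self s
    simp [this]
  simp_rw [this]
  simp [mul_comm]

lemma hat_parseval (P : SignPairing V χ m) (f g : V → ℤ) :
    ∑ x, hatT χ f x * hatT χ g x = 2 ^ m * ∑ s, f s * g s := by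
  have : ∀ x, hatT χ f x * hatT χ g x = ∑ s, g s * (hatT χ f x * χ s x) := by
    intro x
    conv_lhs => rw [show hatT χ g x = ∑ s, g s * χ x s from rfl]
    rw [Finset.mul_sum]
    refine Finset.sum_congr rfl fun s _ => ?_
    rw [P.symm x s]; ring
  simp_rw [this]
  rw [Finset.sum_comm, Finset.mul_sum]
  refine Finset.sum_congr rfl fun s _ => ?_
  rw [← Finset.mul_sum]
  have := hat_hat P f s
  rw [hatT] at this
  rw [this]; ring

lemma hat_mulchar (P : SignPairing V χ m) (f : V → ℤ) (v x : V) :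
    hatT χ (fun s => f s * χ v s) x = hatT χ f (x + v) := by
  unfold hatT
  refine Finset.sum_congr rfl fun s _ => ?_
  rw [P.add]; ring

lemma sum_shift (f : V → ℤ) (v : V) : ∑ x, f (x + v) = ∑ x, f x :=
  Fintype.sum_equiv (Equiv.addRight v) _ _ (fun _ => rfl)

lemma sum_shift' (f : V → ℤ) (v : V) : ∑ x, f (v + x) = ∑ x, f x :=
  Fintype.sum_equiv (Equiv.addLeft v) _ _ (fun _ => rfl)

lemma chi_sq (P : SignPairing V χ m) (x s : V) : χ x s * χ x s = 1 := by
  rcases P.pm x s with h | h <;> simp [h]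

lemma hat_conv (P : SignPairing V χ m) (f g : V → ℤ) (x : V) :
    hatT χ (convT f g) x = hatT χ f x * hatT χ g x := by
  unfold convT
  rw [hatT]
  simp_rw [Finset.sum_mul]
  rw [Finset.sum_comm]
  have : ∀ y, ∑ w, f y * g (y + w) * χ x w = f y * χ x y * hatT χ g x := by
    intro y
    have h1 : ∀ w, f y * g (y + w) * χ x w = f y * χ x y * (g (y + w) * χ x (y + w)) := by
      intro w
      have : χ x (y + w) = χ x y * χ x w := by
        rw [P.symm, P.add, P.symm y, P.symm w]
      rw [this]
      have := chi_sq P x y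
      linear_combination (- f y * g (y + w) * χ x w) * this
    simp_rw [h1, ← Finset.mul_sum]
    rw [sum_shift' (fun z => g z * χ x z) y]; rfl
  simp_rw [this, ← Finset.sum_mul]
  rfl

lemma tern_sq {f : V → ℤ} (h : IsTern f) (x : V) : (f x) ^ 2 * (f x) ^ 2 = (f x) ^ 2 := by
  rcases h x with h | h | h <;> simp [h]

lemma tern_abs {f : V → ℤ} (h : IsTern f) (x : V) : |f x| = (f x) ^ 2 := by
  rcases h x with h | h | h <;> simp [h]

lemma zero_mem_stab (f : V → ℤ) : (0 : V) ∈ stabT f := by simp [stabT]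

lemma stab_facts (P : SignPairing V χ m) (f : V → ℤ) :
    (∃ j, (stabT f).card = 2 ^ j) ∧ ((stabT f).card : ℤ) ∣ ∑ x, (f x) ^ 2 := by
  classical
  have hadd : ∀ a b : V, a ∈ stabT f → b ∈ stabT f → a + b ∈ stabT f := by
    intro a b ha hb
    simp only [stabT, Finset.mem_filter, Finset.mem_univ, true_and] at *
    intro x
    rw [← add_assoc, hb, ha]
  have hneg : ∀ x : V, -x = x := fun x => neg_eq_of_add_eq_zero_left (P.self x)
  let H : AddSubgroup V :=
    { carrier := {v | v ∈ stabT f}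
      add_mem' := fun {a b} ha hb => hadd a b ha hb
      zero_mem' := zero_mem_stab f
      neg_mem' := fun {a} ha => by simpa [hneg] using ha }
  have hcard : Nat.card H = (stabT f).card := by
    have : Nat.card H = Nat.card (stabT f) := rfl
    rw [this]; simp
  constructor
  · have h1 : Nat.card H ∣ Nat.card V := AddSubgroup.card_addSubgroup_dvd_card H
    rw [hcard, Nat.card_eq_fintype_card, P.card] at h1
    obtain ⟨j, _, hj⟩ := (Nat.dvd_prime_pow Nat.prime_two).1 h1
    exact ⟨j, hj⟩
  · have e := (AddSubgroup.addGroupEquivQuotientProdAddSubgroup (s := H))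
    rw [← hcard]
    have key : ∀ (x : V) (h : H), (f (x + h)) ^ 2 = (f x) ^ 2 := by
      intro x h
      have := h.2
      change (h : V) ∈ stabT f at this
      simp only [stabT, Finset.mem_filter, Finset.mem_univ, true_and] at this
      exact this x
    have fib : ∀ q : V ⧸ H, ((Nat.card H : ℕ) : ℤ) ∣
        ∑ x ∈ Finset.univ.filter (fun x : V => (x : V ⧸ H) = q), (f x) ^ 2 := by
      intro q
      obtain ⟨x0, rfl⟩ := QuotientAddGroup.mk_surjective q
      have : ∑ x ∈ Finset.univ.filter (fun x : V => (x : V ⧸ H) = (x0 : V ⧸ H)), (f x) ^ 2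
          = ∑ h : H, (f x0) ^ 2 := by
        symm
        refine Finset.sum_bij (fun (h : H) _ => x0 + (h : V)) ?_ ?_ ?_ ?_
        · intro h _
          simp
        · intro h _ h' _ e
          exact Subtype.ext (add_left_cancel e)
        · intro b hb
          simp only [Finset.mem_filter, Finset.mem_univ, true_and] at hb
          have := QuotientAddGroup.eq.1 hb.symm
          exact ⟨⟨-x0 + b, this⟩, Finset.mem_univ _, by simp⟩
        · intro h _
          exact (key x0 h).symm
      rw [this]
      simp
    rw [← Finset.sum_fiberwise Finset.univ (fun x : V => (x : V ⧸ H))]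
    exact Finset.dvd_sum fun q _ => fib q


structure DualPair (χ : V → V → ℤ) (a F : V → ℤ) (r k : ℕ) : Prop where
  ta : IsTern a
  tF : IsTern F
  ha : ∀ x, hatT χ a x = 2 ^ r * F x
  hF : ∀ x, hatT χ F x = 2 ^ k * a x

lemma DualPair.swap {a F : V → ℤ} {r k : ℕ} (D : DualPair χ a F r k) : DualPair χ F a k r :=
  ⟨D.tF, D.ta, D.hF, D.ha⟩

lemma corr_rel {a F : V → ℤ} {r k : ℕ} (P : SignPairing V χ (r + k)) (D : DualPair χ a F r k)
    (v : V) : 2 ^ r * convT F F v = 2 ^ k * ∑ s, (a s) ^ 2 * χ v s := by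
  have h := hat_parseval P a (fun s => a s * χ v s)
  simp_rw [hat_mulchar P, D.ha] at h
  have h1 : ∑ x, 2 ^ r * F x * (2 ^ r * F (x + v)) = 2 ^ r * (2 ^ r * convT F F v) := by
    unfold convT
    rw [Finset.mul_sum, Finset.mul_sum]
    exact Finset.sum_congr rfl fun x _ => by ring
  have h2 : ∑ s, a s * (a s * χ v s) = ∑ s, (a s) ^ 2 * χ v s :=
    Finset.sum_congr rfl fun x _ => by ring
  rw [h1, h2, pow_add, mul_assoc] at h
  exact mul_left_cancel₀ (by positivity) h

lemma chi_zero (P : SignPairing V χ m) (s : V) : χ 0 s = 1 := by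
  have h := P.add 0 0 s
  have h2 := chi_sq P 0 s
  rw [add_zero] at h
  rw [h]; exact h2

lemma conv_zero (f : V → ℤ) : convT f f 0 = ∑ x, (f x) ^ 2 := by
  unfold convT
  exact Finset.sum_congr rfl fun x _ => by rw [add_zero]; ring

lemma card_rel {a F : V → ℤ} {r k : ℕ} (P : SignPairing V χ (r + k)) (D : DualPair χ a F r k) :
    2 ^ r * ∑ x, (F x) ^ 2 = 2 ^ k * ∑ s, (a s) ^ 2 := by
  have := corr_rel P D 0
  rw [conv_zero] at this
  simpa [chi_zero P] using this

lemma one_add_nonneg (P : SignPairing V χ m) {ε : ℤ} (hε : ε = 1 ∨ ε = -1) (v s : V) :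
    1 + ε * χ v s = 0 ∨ 1 + ε * χ v s = 2 := by
  rcases hε with rfl | rfl <;> rcases P.pm v s with h | h <;> simp [h]

lemma half_hat (P : SignPairing V χ m) (f : V → ℤ) (ε : ℤ) (v x : V) :
    hatT χ (fun s => f s * (1 + ε * χ v s)) x = hatT χ f x + ε * hatT χ f (x + v) := by
  rw [← hat_mulchar P]
  unfold hatT
  rw [Finset.mul_sum, ← Finset.sum_add_distrib]
  exact Finset.sum_congr rfl fun s _ => by ring

lemma abs_hat_le (P : SignPairing V χ m) (f : V → ℤ) (x : V) :
    |hatT χ f x| ≤ ∑ s, |f s| := by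
  unfold hatT
  refine (Finset.abs_sum_le_sum_abs _ _).trans (Finset.sum_le_sum fun s _ => ?_)
  rw [abs_mul]
  rcases P.pm x s with h | h <;> simp [h]

lemma half_abs (P : SignPairing V χ m) {f : V → ℤ} (tf : IsTern f) {ε : ℤ}
    (hε : ε = 1 ∨ ε = -1) (v : V) :
    ∑ s, |f s * (1 + ε * χ v s)| = ∑ s, (f s) ^ 2 + ε * ∑ s, (f s) ^ 2 * χ v s := by
  rw [Finset.mul_sum, ← Finset.sum_add_distrib]
  refine Finset.sum_congr rfl fun s _ => ?_
  rw [abs_mul, tern_abs tf]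
  rcases one_add_nonneg P hε v s with h | h
  · rw [h]; simp; linear_combination (-(f s) ^ 2) * h
  · rw [h]; simp; linear_combination (-(f s) ^ 2) * h

lemma not_stab {f : V → ℤ} {w : V} (hw : w ∉ stabT f) {ε : ℤ} (hε : ε = 1 ∨ ε = -1) :
    ∃ s, f s + ε * f (s + w) ≠ 0 := by
  by_contra hc
  push Not at hc
  apply hw
  simp only [stabT, Finset.mem_filter, Finset.mem_univ, true_and]
  intro x
  have := hc x
  have h1 : f x = - (ε * f (x + w)) := by linarith
  rw [h1]
  rcases hε with rfl | rfl <;> ring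

lemma conv_bound_aux {a F : V → ℤ} {r k : ℕ} (P : SignPairing V χ (r + k))
    (D : DualPair χ a F r k) {w : V} (hw : w ∉ stabT a) {ε : ℤ} (hε : ε = 1 ∨ ε = -1) :
    2 ^ r ≤ ∑ s, (a s) ^ 2 + ε * convT a a w := by
  obtain ⟨s, hs⟩ := not_stab hw hε
  have h1 := abs_hat_le P (fun x => F x * (1 + ε * χ w x)) s
  rw [half_abs P D.tF hε, half_hat P, D.hF, D.hF] at h1
  have h2 : (2 : ℤ) ^ k ≤ |2 ^ k * a s + ε * (2 ^ k * a (s + w))| := by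
    rw [show (2 : ℤ) ^ k * a s + ε * (2 ^ k * a (s + w)) = 2 ^ k * (a s + ε * a (s + w)) by ring,
      abs_mul, abs_of_pos (by positivity : (0 : ℤ) < 2 ^ k)]
    have := Int.one_le_abs hs
    nlinarith [(by positivity : (0 : ℤ) < 2 ^ k)]
  have h3 := h2.trans h1
  have P' : SignPairing V χ (k + r) := by rw [add_comm]; exact P
  have h4 := corr_rel P' D.swap w
  have h5 := card_rel P D
  have h6 : (0 : ℤ) < 2 ^ k := by positivity
  have h7 : (0 : ℤ) < 2 ^ r := by positivity
  have h8 := mul_le_mul_of_nonneg_left h3 h7.le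
  have h9 : (2 : ℤ) ^ k * 2 ^ r ≤ 2 ^ k * (∑ s, (a s) ^ 2 + ε * convT a a w) := by
    calc (2 : ℤ) ^ k * 2 ^ r = 2 ^ r * 2 ^ k := by ring
      _ ≤ _ := h8
      _ = _ := by linear_combination h5 - ε * h4
  exact le_of_mul_le_mul_left h9 h6

lemma conv_le_card {f : V → ℤ} (tf : IsTern f) (w : V) :
    |convT f f w| ≤ ∑ s, (f s) ^ 2 := by
  unfold convT
  refine (Finset.abs_sum_le_sum_abs _ _).trans (Finset.sum_le_sum fun s _ => ?_)
  rw [abs_mul, tern_abs tf, tern_abs tf]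
  rcases tf s with h | h | h <;> rcases tf (s + w) with h' | h' | h' <;> simp [h, h']

lemma conv_bound {a F : V → ℤ} {r k : ℕ} (P : SignPairing V χ (r + k))
    (D : DualPair χ a F r k) (w : V) :
    |convT a a w| ≤ (∑ s, (a s) ^ 2 - 2 ^ r) + 2 ^ r * (if w ∈ stabT a then 1 else 0) := by
  split_ifs with hw
  · have := conv_le_card D.ta w
    linarith
  · have h1 := conv_bound_aux P D hw (Or.inl rfl)
    have h2 := conv_bound_aux P D hw (Or.inr rfl)
    rw [abs_le]
    constructor <;> linarith

lemma step_two {a F : V → ℤ} {r k : ℕ} (P : SignPairing V χ (r + k)) (D : DualPair χ a F r k)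
    {v : V} {ε : ℤ} (hε : ε = 1 ∨ ε = -1)
    (hv : ∑ s, (a s) ^ 2 + ε * ∑ s, (a s) ^ 2 * χ v s = 2 ^ r) :
    2 ^ (r + 1) - ∑ s, (a s) ^ 2 ≤ 2 * ((stabT a).card : ℤ) := by
  set A := ∑ s, (a s) ^ 2 with hA
  set b : V → ℤ := fun s => a s * (1 + ε * χ v s) with hb
  set p : ℤ := ((stabT a).card : ℤ) with hp
  have hε2 : ε * ε = 1 := by rcases hε with rfl | rfl <;> rfl
  have hk : (0 : ℤ) < 2 ^ k := by positivity
  have hr : (0 : ℤ) < 2 ^ r := by positivity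
  have hsb : ∑ s, |b s| = 2 ^ r := by rw [hb, half_abs P D.ta hε, hv]
  have hb2 : ∀ s, |b s| ≤ 2 := by
    intro s
    rw [hb]; simp only [abs_mul]
    rcases one_add_nonneg P hε v s with h | h <;> rw [h] <;>
      rcases D.ta s with h' | h' | h' <;> simp [h']
  have hbb : ∀ s, b s * b s = 2 * |b s| := by
    intro s
    rw [hb]; simp only [abs_mul]
    rcases one_add_nonneg P hε v s with h | h <;> rw [h] <;>
      rcases D.ta s with h' | h' | h' <;> simp [h']
  have hbhat : ∀ x, hatT χ b x = 2 ^ r * (F x + ε * F (x + v)) := by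
    intro x; rw [hb, half_hat P, D.ha, D.ha]; ring
  -- sum of squares of F + ε F_v
  have hq : ∑ x, (F x + ε * F (x + v)) ^ 2 = 2 * 2 ^ k := by
    have h := hat_parseval P b b
    simp_rw [hbb, ← Finset.mul_sum, hsb, hbhat] at h
    have h1 : ∑ x, 2 ^ r * (F x + ε * F (x + v)) * (2 ^ r * (F x + ε * F (x + v)))
        = (2 ^ r * 2 ^ r) * ∑ x, (F x + ε * F (x + v)) ^ 2 := by
      rw [Finset.mul_sum]; exact Finset.sum_congr rfl fun x _ => by ring
    rw [h1, pow_add] at h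
    refine mul_left_cancel₀ (mul_pos hr hr).ne' ?_
    rw [h]; ring
  have hy : 2 ^ k ≤ ∑ x, (F x + ε * F (x + v)) ^ 2 * (F x) ^ 2 := by
    have h1 : ∑ x, (F x + ε * F (x + v)) ^ 2 * (F x) ^ 2
        = ∑ x, (F x + ε * F (x + v)) ^ 2 * (F (x + v)) ^ 2 := by
      rw [← sum_shift (fun x => (F x + ε * F (x + v)) ^ 2 * (F x) ^ 2) v]
      refine Finset.sum_congr rfl fun x _ => ?_
      have : x + v + v = x := by rw [add_assoc, P.self, add_zero]
      simp only [this]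
      have : (F (x + v) + ε * F x) ^ 2 = (F x + ε * F (x + v)) ^ 2 := by
        linear_combination ((F x) ^ 2 - (F (x + v)) ^ 2) * hε2
      rw [this]
    have h2 : ∑ x, (F x + ε * F (x + v)) ^ 2 ≤
        ∑ x, (F x + ε * F (x + v)) ^ 2 * (F x) ^ 2
        + ∑ x, (F x + ε * F (x + v)) ^ 2 * (F (x + v)) ^ 2 := by
      rw [← Finset.sum_add_distrib]
      refine Finset.sum_le_sum fun x _ => ?_
      rcases hε with rfl | rfl <;> rcases D.tF x with h | h | h <;>
        rcases D.tF (x + v) with h' | h' | h' <;> rw [h, h'] <;> norm_num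
    rw [← h1, hq] at h2
    linarith
  -- lower bound of Z
  set Z := ∑ s, b s * convT b (convT a a) s with hZ
  have hZl : 2 ^ r * 2 ^ r * 2 ^ r ≤ Z := by
    have h := hat_parseval P b (convT b (convT a a))
    simp_rw [hat_conv P, hbhat, D.ha] at h
    have h1 : ∑ x, 2 ^ r * (F x + ε * F (x + v)) *
        (2 ^ r * (F x + ε * F (x + v)) * (2 ^ r * F x * (2 ^ r * F x)))
        = (2 ^ r * 2 ^ r * 2 ^ r * 2 ^ r) * ∑ x, (F x + ε * F (x + v)) ^ 2 * (F x) ^ 2 := by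
      rw [Finset.mul_sum]; exact Finset.sum_congr rfl fun x _ => by ring
    rw [h1, pow_add, ← hZ] at h
    have h2 := mul_le_mul_of_nonneg_left hy
      (by positivity : (0 : ℤ) ≤ 2 ^ r * 2 ^ r * 2 ^ r * 2 ^ r)
    rw [h] at h2
    refine le_of_mul_le_mul_left (a := 2 ^ r * 2 ^ k) ?_ (by positivity)
    linarith
  -- upper bound
  have hin : ∀ s, ∑ t, |b t| * (if t + s ∈ stabT a then (1 : ℤ) else 0) ≤ 2 * p := by
    intro s
    have h1 : ∑ t, |b t| * (if t + s ∈ stabT a then (1 : ℤ) else 0)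
        ≤ ∑ t, 2 * (if t + s ∈ stabT a then (1 : ℤ) else 0) := by
      refine Finset.sum_le_sum fun t _ => ?_
      exact mul_le_mul_of_nonneg_right (hb2 t) (by split_ifs <;> norm_num)
    refine h1.trans (le_of_eq ?_)
    rw [← Finset.mul_sum, sum_shift (fun t => if t ∈ stabT a then (1 : ℤ) else 0) s]
    simp [hp]
  have hZu : Z ≤ 2 ^ r * (2 ^ r * (A - 2 ^ r) + 2 ^ r * (2 * p)) := by
    have h1 : ∀ s, b s * convT b (convT a a) s ≤
        |b s| * (2 ^ r * (A - 2 ^ r) + 2 ^ r * (2 * p)) := by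
      intro s
      refine (le_abs_self _).trans ?_
      rw [abs_mul]
      refine mul_le_mul_of_nonneg_left ?_ (abs_nonneg _)
      rw [show convT b (convT a a) s = ∑ t, b t * convT a a (t + s) from rfl]
      refine (Finset.abs_sum_le_sum_abs _ _).trans ?_
      have h2 : ∀ t, |b t * convT a a (t + s)| ≤ |b t| * (A - 2 ^ r) +
          2 ^ r * (|b t| * (if t + s ∈ stabT a then (1 : ℤ) else 0)) := by
        intro t
        rw [abs_mul]
        have := mul_le_mul_of_nonneg_left (conv_bound P D (t + s)) (abs_nonneg (b t))
        refine this.trans (le_of_eq ?_)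
        ring
      refine (Finset.sum_le_sum fun t _ => h2 t).trans ?_
      rw [Finset.sum_add_distrib, ← Finset.sum_mul, ← Finset.mul_sum, hsb]
      have := mul_le_mul_of_nonneg_left (hin s) hr.le
      linarith
    have h3 := Finset.sum_le_sum fun s (_ : s ∈ Finset.univ) => h1 s
    rw [← Finset.sum_mul, hsb] at h3
    exact h3
  have hfin : 2 ^ r * 2 ^ r * (2 ^ r) ≤ 2 ^ r * 2 ^ r * (A - 2 ^ r + 2 * p) := by
    refine (hZl.trans hZu).trans (le_of_eq (by ring))
  have := le_of_mul_le_mul_left hfin (by positivity)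
  rw [pow_succ]; linarith

/-- The inductive claim. -/
def Claim (χ : V → V → ℤ) (r : ℕ) : Prop :=
  ∀ f : V → ℤ, IsTern f → (∀ x, (2 : ℤ) ^ r ∣ hatT χ f x) → ∑ x, (f x) ^ 2 < 2 ^ (r + 1) →
    ∃ i : ℕ, ∑ x, (f x) ^ 2 + 2 ^ i = 2 ^ (r + 1)

lemma sigma_bound {a F : V → ℤ} {r k : ℕ} (P : SignPairing V χ (r + 1 + k))
    (D : DualPair χ a F (r + 1) k) (IH : Claim χ r)
    (hlt : ∑ s, (a s) ^ 2 < 2 ^ (r + 2))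
    (hno : ∀ v : V, ∀ ε : ℤ, (ε = 1 ∨ ε = -1) →
      ∑ s, (a s) ^ 2 + ε * ∑ s, (a s) ^ 2 * χ v s ≠ 2 ^ (r + 1))
    {v : V} (hv : v ∉ stabT F) :
    2 * |∑ s, (a s) ^ 2 * χ v s| ≤ 2 * ∑ s, (a s) ^ 2 - 3 * 2 ^ (r + 1) := by
  set σ := ∑ s, (a s) ^ 2 * χ v s with hσ
  set A := ∑ s, (a s) ^ 2 with hA
  obtain ⟨ε, hε, hεσ⟩ : ∃ ε : ℤ, (ε = 1 ∨ ε = -1) ∧ ε * σ = -|σ| := by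
    rcases le_total 0 σ with h | h
    · exact ⟨-1, Or.inr rfl, by rw [abs_of_nonneg h]; ring⟩
    · exact ⟨1, Or.inl rfl, by rw [abs_of_nonpos h]; ring⟩
  set b : V → ℤ := fun s => if 1 + ε * χ v s = 0 then 0 else a s with hb
  have hb2 : ∀ s, a s * (1 + ε * χ v s) = 2 * b s := by
    intro s
    rcases one_add_nonneg P hε v s with h | h <;> simp [hb, h]; ring
  have tb : IsTern b := by
    intro s
    simp only [hb]
    split_ifs
    · exact Or.inl rfl
    · exact D.ta s
  have hbh : ∀ x, hatT χ b x = 2 ^ r * (F x + ε * F (x + v)) := by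
    intro x
    have h1 := half_hat P a ε v x
    simp_rw [hb2, D.ha] at h1
    have h2 : hatT χ (fun s => 2 * b s) x = 2 * hatT χ b x := by
      unfold hatT; rw [Finset.mul_sum]; exact Finset.sum_congr rfl fun s _ => by ring
    rw [h2, pow_succ] at h1
    linarith
  have hbs : 2 * ∑ s, (b s) ^ 2 = A - |σ| := by
    have h1 := half_abs P D.ta hε v
    simp_rw [hb2, abs_mul, tern_abs tb, ← Finset.mul_sum] at h1
    rw [← hσ, ← hA, hεσ] at h1
    simp at h1
    linarith
  have hpos : 0 ≤ |σ| := abs_nonneg σ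
  obtain ⟨i, hi⟩ := IH b tb (fun x => ⟨_, hbh x⟩) (by
    have : (2 : ℤ) ^ (r + 2) = 2 * 2 ^ (r + 1) := by ring
    linarith)
  have hno' := hno v ε hε
  rw [← hσ, hεσ] at hno'
  have hne : ∑ s, (b s) ^ 2 ≠ 0 := by
    intro h0
    obtain ⟨s, hs⟩ := not_stab hv hε
    have h1 := (Finset.sum_eq_zero_iff_of_nonneg (fun s _ => sq_nonneg (b s))).1 h0
    have h2 : hatT χ b s = 0 := by
      unfold hatT
      refine Finset.sum_eq_zero fun t _ => ?_
      have := h1 t (Finset.mem_univ t)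
      rw [pow_eq_zero_iff (by norm_num)] at this
      rw [this, zero_mul]
    rw [hbh] at h2
    rcases mul_eq_zero.1 h2 with h | h
    · exact absurd h (by positivity)
    · exact hs h
  have hnn : 0 ≤ ∑ s, (b s) ^ 2 := Finset.sum_nonneg fun s _ => sq_nonneg (b s)
  have hile : i + 1 ≤ r := by
    have h1 : i < r + 1 := by
      by_contra hc
      have : (2 : ℤ) ^ (r + 1) ≤ 2 ^ i := pow_le_pow_right₀ (by norm_num) (by omega)
      exact hne (by linarith)
    rcases Nat.lt_succ_iff_lt_or_eq.1 h1 with h | h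
    · exact h
    · exfalso
      subst h
      apply hno'
      rw [pow_succ] at hi ⊢
      linarith
  have h1 : (2 : ℤ) ^ (i + 1) ≤ 2 ^ r := pow_le_pow_right₀ (by norm_num) hile
  rw [pow_succ] at h1 hi ⊢
  linarith

lemma step_one {a F : V → ℤ} {r k : ℕ} (P : SignPairing V χ (r + 1 + k))
    (D : DualPair χ a F (r + 1) k) (IH : Claim χ r)
    (hlt : ∑ s, (a s) ^ 2 < 2 ^ (r + 2)) (hgt : 2 ^ (r + 1) < ∑ s, (a s) ^ 2) :
    ∃ v : V, ∃ ε : ℤ, (ε = 1 ∨ ε = -1) ∧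
      ∑ s, (a s) ^ 2 + ε * ∑ s, (a s) ^ 2 * χ v s = 2 ^ (r + 1) := by
  by_contra hc
  have hno : ∀ v : V, ∀ ε : ℤ, (ε = 1 ∨ ε = -1) →
      ∑ s, (a s) ^ 2 + ε * ∑ s, (a s) ^ 2 * χ v s ≠ 2 ^ (r + 1) :=
    fun v ε hε h => hc ⟨v, ε, hε, h⟩
  have hσb := fun v => sigma_bound P D IH hlt hno (v := v)
  have hcr := card_rel P D
  have hco := corr_rel P D
  set σ : V → ℤ := fun v => ∑ s, (a s) ^ 2 * χ v s with hσ
  set A := ∑ s, (a s) ^ 2 with hA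
  set N := ∑ x, (F x) ^ 2 with hN
  obtain ⟨⟨j, hj⟩, hdvd⟩ := stab_facts P F
  rw [← hN] at hdvd
  set p : ℤ := ((stabT F).card : ℤ) with hp
  set R : ℤ := 2 ^ (r + 1) with hR
  set K : ℤ := 2 ^ k with hK
  have hR0 : 0 < R := by positivity
  have hK0 : 0 < K := by positivity
  have hlt' : A < 2 * R := by rw [hR]; rw [pow_succ] at hlt; linarith
  have hN1 : N < 2 * K := by nlinarith
  have hN0 : K < N := by nlinarith
  have hpj : p = 2 ^ j := by rw [hp, hj]; push_cast; rfl
  have hp0 : 0 < p := by rw [hpj]; positivity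
  -- p ≤ 2K - N
  have hple : p ≤ 2 * K - N := by
    have h1 : p ≤ N := Int.le_of_dvd (by linarith) hdvd
    have h2 : j ≤ k := by
      by_contra hcc
      have : (2 : ℤ) ^ (k + 1) ≤ 2 ^ j := pow_le_pow_right₀ (by norm_num) (by omega)
      rw [pow_succ] at this
      rw [hpj] at h1
      linarith
    have h3 : p ∣ 2 * K := by
      rw [hpj]; exact Dvd.dvd.mul_left (pow_dvd_pow 2 h2) 2
    exact Int.le_of_dvd (by linarith) (dvd_sub h3 hdvd)
  -- Parseval for a^2
  have hpars : ∑ v, (σ v) ^ 2 = R * K * A := by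
    have h := hat_parseval P (fun s => (a s) ^ 2) (fun s => (a s) ^ 2)
    simp_rw [tern_sq D.ta] at h
    rw [pow_add, ← hA] at h
    rw [← h]
    exact Finset.sum_congr rfl fun v _ => by rw [sq]; rfl
  -- unsigned autocorrelation of F
  set ρ : V → ℤ := fun v => ∑ x, (F x) ^ 2 * (F (x + v)) ^ 2 with hρ
  have hρsum : ∑ v, ρ v = N * N := by
    simp only [hρ]
    rw [Finset.sum_comm, hN, Finset.sum_mul]
    refine Finset.sum_congr rfl fun x _ => ?_
    rw [← Finset.mul_sum, sum_shift' (fun z => (F z) ^ 2) x]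
  have hσρ : ∀ v, K * |σ v| ≤ R * ρ v := by
    intro v
    have h1 := hco v
    have h2 : K * |σ v| = R * |convT F F v| := by
      have h3 : |R * convT F F v| = |K * σ v| := by rw [h1]
      rw [abs_mul, abs_mul, abs_of_pos hK0, abs_of_pos hR0] at h3
      exact h3.symm
    rw [h2]
    refine mul_le_mul_of_nonneg_left ?_ hR0.le
    unfold convT
    refine (Finset.abs_sum_le_sum_abs _ _).trans (le_of_eq ?_)
    refine Finset.sum_congr rfl fun x _ => ?_
    rw [abs_mul, tern_abs D.tF, tern_abs D.tF]
  have hρst : ∀ v ∈ stabT F, ρ v = N := by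
    intro v hv
    simp only [stabT, Finset.mem_filter, Finset.mem_univ, true_and] at hv
    simp only [hρ, hN]
    exact Finset.sum_congr rfl fun x _ => by rw [hv, tern_sq D.tF]
  have hσA : ∀ v, |σ v| ≤ A := by
    intro v
    have h1 := abs_hat_le P (fun s => (a s) ^ 2) v
    have h2 : ∑ s, |(a s) ^ 2| = A :=
      Finset.sum_congr rfl fun s _ => abs_of_nonneg (sq_nonneg (a s))
    rw [h2] at h1
    exact h1
  -- split
  set C := (stabT F)ᶜ with hC
  have hsplit1 : ∑ v ∈ stabT F, (σ v) ^ 2 + ∑ v ∈ C, (σ v) ^ 2 = R * K * A := by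
    rw [← hpars]; exact Finset.sum_add_sum_compl _ _
  have hsplit2 : ∑ v ∈ stabT F, ρ v + ∑ v ∈ C, ρ v = N * N := by
    rw [← hρsum]; exact Finset.sum_add_sum_compl _ _
  have hst1 : ∑ v ∈ stabT F, (σ v) ^ 2 ≤ p * (A * A) := by
    have : ∑ v ∈ stabT F, (σ v) ^ 2 ≤ ∑ v ∈ stabT F, A * A := by
      refine Finset.sum_le_sum fun v _ => ?_
      rw [← sq_abs, sq]
      exact mul_self_le_mul_self (abs_nonneg _) (hσA v)
    refine this.trans (le_of_eq ?_)
    simp [hp]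
  have hst2 : ∑ v ∈ stabT F, ρ v = p * N := by
    rw [Finset.sum_congr rfl hρst]; simp [hp]
  have hKA : K * A = R * N := hcr.symm
  have hNp : p ≤ N := Int.le_of_dvd (by linarith) hdvd
  have hA0 : 0 < A := by linarith
  obtain ⟨M, hM0, hM1, hM2⟩ : ∃ M : ℤ, 0 ≤ M ∧ (∀ v ∈ C, 2 * |σ v| ≤ M) ∧
      (M = 2 * A - 3 * R ∨ M = 0) := by
    rcases le_total 0 (2 * A - 3 * R) with h | h
    · refine ⟨2 * A - 3 * R, h, ?_, Or.inl rfl⟩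
      intro v hv
      exact hσb v (by simpa [hC] using hv)
    · refine ⟨0, le_rfl, ?_, Or.inr rfl⟩
      intro v hv
      exact (hσb v (by simpa [hC] using hv)).trans h
  have hCs : 2 * (K * ∑ v ∈ C, (σ v) ^ 2) ≤ M * (R * (N * N - p * N)) := by
    have h1 : ∀ v ∈ C, 2 * (K * (σ v) ^ 2) ≤ M * (R * ρ v) := by
      intro v hv
      have h2 := hM1 v hv
      have h3 := hσρ v
      calc 2 * (K * (σ v) ^ 2) = (2 * |σ v|) * (K * |σ v|) := by
            rw [← sq_abs]; ring
        _ ≤ M * (R * ρ v) := mul_le_mul h2 h3 (by positivity) hM0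
    have h4 := Finset.sum_le_sum h1
    rw [← Finset.mul_sum, ← Finset.mul_sum, ← Finset.mul_sum, ← Finset.mul_sum] at h4
    have h5 : ∑ v ∈ C, ρ v = N * N - p * N := by linarith
    rwa [h5] at h4
  have hmain : 2 * (R * K) ≤ 2 * (p * A) + M * (N - p) := by
    have h1 : (K * A) * (2 * (R * K)) ≤ (K * A) * (2 * (p * A) + M * (N - p)) := by
      calc (K * A) * (2 * (R * K)) = 2 * (K * (R * K * A)) := by ring
        _ = 2 * (K * ∑ v ∈ stabT F, (σ v) ^ 2) + 2 * (K * ∑ v ∈ C, (σ v) ^ 2) := by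
            rw [← hsplit1]; ring
        _ ≤ 2 * (K * (p * (A * A))) + M * (R * (N * N - p * N)) := by
            have := mul_le_mul_of_nonneg_left hst1 hK0.le
            linarith
        _ = (K * A) * (2 * (p * A)) + M * (R * N) * (N - p) := by ring
        _ = (K * A) * (2 * (p * A) + M * (N - p)) := by rw [← hKA]; ring
    exact le_of_mul_le_mul_left h1 (by positivity)
  rcases hM2 with rfl | rfl
  · -- 2RK ≤ p(2A - M) + M N = 3 R p + (2A-3R) N
    have h1 : p * (3 * R) ≤ (2 * K - N) * (3 * R) :=
      mul_le_mul_of_nonneg_right hple (by positivity)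
    -- 2RK ≤ 3R(2K-N) + (2A-3R)N
    have h2 : 2 * (R * K) ≤ 3 * R * (2 * K - N) + (2 * A - 3 * R) * N := by nlinarith
    have h3 : 0 < (N - K) * (2 * R - A) := mul_pos (by linarith) (by linarith)
    nlinarith
  · have h1 : p * A ≤ (2 * K - N) * A := mul_le_mul_of_nonneg_right hple hA0.le
    have h3 : 0 < (N - K) * (A - R) := mul_pos (by linarith) (by linarith)
    nlinarith

theorem claim_all (P : SignPairing V χ m) : ∀ r, Claim χ r := by
  intro r
  induction r with
  | zero =>
    intro f tf _ hlt
    have hnn : 0 ≤ ∑ s, (f s) ^ 2 := Finset.sum_nonneg fun s _ => sq_nonneg (f s)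
    norm_num at hlt
    obtain h | h : ∑ s, (f s) ^ 2 = 0 ∨ ∑ s, (f s) ^ 2 = 1 := by omega
    · exact ⟨1, by rw [h]; norm_num⟩
    · exact ⟨0, by rw [h]; norm_num⟩
  | succ r IH =>
    intro a ta hdiv hlt
    set A := ∑ s, (a s) ^ 2 with hA
    have hnn : 0 ≤ A := Finset.sum_nonneg fun s _ => sq_nonneg (a s)
    by_cases hA0 : A = 0
    · exact ⟨r + 2, by rw [hA0]; ring⟩
    choose F hF using hdiv
    have tF : IsTern F := by
      intro x
      have h1 := abs_hat_le P a x
      simp_rw [tern_abs ta] at h1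
      rw [hF, abs_mul, abs_of_pos (by positivity : (0 : ℤ) < 2 ^ (r + 1)), ← hA] at h1
      have h2 : |F x| < 2 := by
        have h3 : (2 : ℤ) ^ (r + 1) * |F x| < 2 ^ (r + 1) * 2 := by
          rw [← pow_succ]; linarith
        exact lt_of_mul_lt_mul_left h3 (by positivity)
      rw [abs_lt] at h2
      have := h2.1
      have := h2.2
      omega
    -- nonzero value
    obtain ⟨x0, hx0⟩ : ∃ x, F x ≠ 0 := by
      by_contra hc
      push Not at hc
      have h := hat_parseval P a a
      simp_rw [hF, hc] at h
      simp only [mul_zero, Finset.sum_const_zero] at h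
      simp only [← sq] at h
      rcases mul_eq_zero.1 h.symm with h | h
      · exact absurd h (by positivity)
      · exact hA0 h
    have hge : 2 ^ (r + 1) ≤ A := by
      have h1 := abs_hat_le P a x0
      simp_rw [tern_abs ta] at h1
      rw [hF, abs_mul, abs_of_pos (by positivity : (0 : ℤ) < 2 ^ (r + 1)), ← hA] at h1
      have := Int.one_le_abs hx0
      have h7 : (0 : ℤ) < 2 ^ (r + 1) := by positivity
      nlinarith
    have hrm : r + 1 ≤ m := by
      have h1 : A ≤ 2 ^ m := by
        have : A ≤ ∑ s : V, (1 : ℤ) := by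
          refine Finset.sum_le_sum fun s _ => ?_
          rcases ta s with h | h | h <;> simp [h]
        refine this.trans (le_of_eq ?_)
        simp [P.card]
      exact (pow_le_pow_iff_right₀ (by norm_num : (1 : ℤ) < 2)).1 (hge.trans h1)
    obtain ⟨k, rfl⟩ := Nat.exists_eq_add_of_le hrm
    have D : DualPair χ a F (r + 1) k := by
      refine ⟨ta, tF, hF, ?_⟩
      intro x
      have h1 := hat_hat P a x
      have h2 : hatT χ (hatT χ a) x = 2 ^ (r + 1) * hatT χ F x := by
        conv_lhs => unfold hatT
        rw [show hatT χ F x = ∑ s, F s * χ x s from rfl, Finset.mul_sum]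
        refine Finset.sum_congr rfl fun s _ => ?_
        have := hF s
        unfold hatT at this
        rw [this]; ring
      rw [h2, pow_add 2 (r + 1) k, mul_assoc] at h1
      exact mul_left_cancel₀ (by positivity) h1
    rcases hge.eq_or_lt with heq | hgt
    · exact ⟨r + 1, by rw [← heq]; ring⟩
    obtain ⟨v, ε, hε, hv⟩ := step_one P D IH hlt hgt
    have h2 := step_two P D hε hv
    obtain ⟨⟨j, hj⟩, hdvd⟩ := stab_facts P a
    rw [← hA] at h2 hdvd
    rw [hj] at h2 hdvd
    push_cast at h2 hdvd
    have hle : (2 : ℤ) ^ j ≤ A := Int.le_of_dvd (by omega) hdvd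
    have hjr : j < r + 1 + 1 :=
      (pow_lt_pow_iff_right₀ (by norm_num : (1 : ℤ) < 2)).1 (hle.trans_lt hlt)
    have hd : (2 : ℤ) ^ j ∣ 2 ^ (r + 1 + 1) - A := dvd_sub (pow_dvd_pow 2 hjr.le) hdvd
    obtain ⟨c, hc⟩ := hd
    have hj0 : (0 : ℤ) < 2 ^ j := by positivity
    have hc0 : 0 < c := by
      by_contra hcc
      nlinarith
    have hc2 : c ≤ 2 := by
      by_contra hcc
      nlinarith
    obtain rfl | rfl : c = 1 ∨ c = 2 := by omega
    · exact ⟨j, by linarith⟩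
    · exact ⟨j + 1, by rw [pow_succ]; linarith⟩

end


/-- The sign character pairing on the cube. -/
def cubeChi (v : ℕ) (x s : Fin v → ZMod 2) : ℤ :=
  ∏ i, (1 + (if x i = 1 ∧ s i = 1 then (-2 : ℤ) else 0))

lemma cube_pairing (v : ℕ) : SignPairing (Fin v → ZMod 2) (cubeChi v) v where
  symm x y := by
    unfold cubeChi
    exact Finset.prod_congr rfl fun i _ => by simp only [and_comm]
  add x y s := by
    unfold cubeChi
    rw [← Finset.prod_mul_distrib]
    refine Finset.prod_congr rfl fun i _ => ?_
    have key : ∀ a b c : ZMod 2, (1 + (if a + b = 1 ∧ c = 1 then (-2 : ℤ) else 0)) =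
        (1 + (if a = 1 ∧ c = 1 then (-2 : ℤ) else 0)) *
        (1 + (if b = 1 ∧ c = 1 then (-2 : ℤ) else 0)) := by decide
    exact key (x i) (y i) (s i)
  pm x s := by
    unfold cubeChi
    have key : ∀ T : Finset (Fin v),
        ∏ i ∈ T, (1 + (if x i = 1 ∧ s i = 1 then (-2 : ℤ) else 0)) = 1 ∨
        ∏ i ∈ T, (1 + (if x i = 1 ∧ s i = 1 then (-2 : ℤ) else 0)) = -1 := by
      intro T
      induction T using Finset.induction_on with
      | empty => left; simp
      | insert a T ha ih =>
        rw [Finset.prod_insert ha]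
        rcases ih with h | h <;> rw [h] <;> split_ifs <;> simp
    exact key _
  self x := by
    funext i
    have key : ∀ a : ZMod 2, a + a = 0 := by decide
    exact key (x i)
  orth x := by
    unfold cubeChi
    rw [← Fintype.prod_sum (fun i (c : ZMod 2) =>
      (1 + (if x i = 1 ∧ c = 1 then (-2 : ℤ) else 0)))]
    have h : ∀ i, ∑ c : ZMod 2, (1 + (if x i = 1 ∧ c = 1 then (-2 : ℤ) else 0))
        = if x i = 0 then 2 else 0 := by
      intro i
      generalize x i = a
      revert a
      decide
    simp_rw [h]
    split_ifs with hx
    · subst hx; simp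
    · obtain ⟨i, hi⟩ : ∃ i, x i ≠ 0 := by
        by_contra hc
        push Not at hc
        exact hx (funext hc)
      exact Finset.prod_eq_zero (Finset.mem_univ i) (by simp [hi])
  card := by simp

/-- every `[t]`-trade of volume less than `2^(t+1)` has volume
`2^(t+1) - 2^i` for some `i ∈ {0,…,t+1}`; in particular, for every `i` from `2` to `t`
there is no `[t]`-trade of volume strictly between `2^(t+1) - 2^i` and `2^(t+1) - 2^(i-1)`. -/
theorem tTrade_small_volumes (v t : ℕ) (T0 T1 : Finset (Fin v → ZMod 2))
    (h : IsTrade t v T0 T1) :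
    (T0.card < 2 ^ (t + 1) → ∃ i, i ≤ t + 1 ∧ T0.card = 2 ^ (t + 1) - 2 ^ i) ∧
    (∀ i, 2 ≤ i → i ≤ t →
      ¬(2 ^ (t + 1) - 2 ^ i < T0.card ∧ T0.card < 2 ^ (t + 1) - 2 ^ (i - 1))) := by
  obtain ⟨hdis, hT⟩ := h
  have main : T0.card < 2 ^ (t + 1) → ∃ i, i ≤ t + 1 ∧ T0.card = 2 ^ (t + 1) - 2 ^ i := by
    intro hlt
    set f : (Fin v → ZMod 2) → ℤ :=
      fun x => (if x ∈ T0 then 1 else 0) - (if x ∈ T1 then 1 else 0) with hf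
    have hnot : ∀ x, ¬ (x ∈ T0 ∧ x ∈ T1) := fun x hx =>
      Finset.disjoint_left.1 hdis hx.1 hx.2
    have tf : IsTern f := by
      intro x
      simp only [hf]
      split_ifs <;> simp
    have hcards : T0.card = T1.card := by
      have := hT 0 (by simp [size])
      simpa using this
    have hsum : ∑ x, (f x) ^ 2 = 2 * (T0.card : ℤ) := by
      have h1 : ∀ x, (f x) ^ 2 = (if x ∈ T0 then 1 else 0) + (if x ∈ T1 then 1 else 0) := by
        intro x
        have := hnot x
        simp only [hf]
        split_ifs <;> simp_all
      simp_rw [h1, Finset.sum_add_distrib]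
      simp [← hcards]; ring
    have hdiv : ∀ w, (2 : ℤ) ^ (t + 1) ∣ hatT (cubeChi v) f w := by
      intro w
      unfold hatT cubeChi
      simp_rw [Finset.prod_one_add, Finset.mul_sum]
      rw [Finset.sum_comm]
      refine Finset.dvd_sum fun S _ => ?_
      rcases Nat.lt_or_ge t S.card with hS | hS
      · refine Finset.dvd_sum fun x _ => Dvd.dvd.mul_left ?_ _
        have h1 : (2 : ℤ) ^ S.card ∣ ∏ i ∈ S, (if w i = 1 ∧ x i = 1 then (-2 : ℤ) else 0) := by
          rw [← Finset.prod_const]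
          refine Finset.prod_dvd_prod_of_dvd _ _ fun i _ => ?_
          split_ifs <;> norm_num
        exact (pow_dvd_pow 2 hS).trans h1
      · have hz := hT (fun i => if i ∈ S then 1 else 0) (by simpa [size] using hS)
        have hz' : ∑ x, f x * (if ∀ i ∈ S, x i = 1 then (1 : ℤ) else 0) = 0 := by
          have h1 : ∀ x, f x * (if ∀ i ∈ S, x i = 1 then (1 : ℤ) else 0) =
              (if x ∈ T0 ∧ (∀ i ∈ S, x i = 1) then 1 else 0)
              - (if x ∈ T1 ∧ (∀ i ∈ S, x i = 1) then 1 else 0) := by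
            intro x
            simp only [hf]
            have gen : ∀ (Q R0 R1 : Prop) [Decidable Q] [Decidable R0] [Decidable R1],
                (((if R0 then (1 : ℤ) else 0) - (if R1 then 1 else 0)) * (if Q then 1 else 0)) =
                (if R0 ∧ Q then 1 else 0) - (if R1 ∧ Q then 1 else 0) := by
              intro Q R0 R1 _ _ _
              by_cases hQ : Q <;> by_cases h0 : R0 <;> by_cases h1 : R1 <;> simp [hQ, h0, h1]
            convert gen (∀ i ∈ S, x i = 1) (x ∈ T0) (x ∈ T1)
          simp_rw [h1, Finset.sum_sub_distrib]
          have h2 : ∀ T : Finset (Fin v → ZMod 2),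
              ∑ x, (if x ∈ T ∧ (∀ i ∈ S, x i = 1) then (1 : ℤ) else 0)
              = ((T.filter (fun x => ∀ j, (if j ∈ S then (1 : ZMod 2) else 0) = 1 → x j = 1)).card : ℤ) := by
            intro T
            rw [Finset.sum_boole]
            congr 2
            ext x
            simp
          rw [h2, h2, hz, sub_self]
        have hp : ∀ x : Fin v → ZMod 2, ∏ i ∈ S, (if w i = 1 ∧ x i = 1 then (-2 : ℤ) else 0) =
            (if ∀ i ∈ S, x i = 1 then (1 : ℤ) else 0) *
              ∏ i ∈ S, (if w i = 1 then (-2 : ℤ) else 0) := by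
          intro x
          split_ifs with hx
          · rw [one_mul]
            refine Finset.prod_congr rfl fun i hi => ?_
            simp [hx i hi]
          · push Not at hx
            obtain ⟨i, hi, hxi⟩ := hx
            rw [zero_mul]
            exact Finset.prod_eq_zero hi (by simp [hxi])
        simp_rw [hp, ← mul_assoc, ← Finset.sum_mul]
        rw [hz', zero_mul]
        exact dvd_zero _
    obtain ⟨i, hi⟩ := claim_all (cube_pairing v) (t + 1) f tf hdiv (by
      rw [hsum, pow_succ]
      have : (T0.card : ℤ) < 2 ^ (t + 1) := by exact_mod_cast hlt
      linarith)
    rw [hsum] at hi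
    have hi' : 2 * T0.card + 2 ^ i = 2 * 2 ^ (t + 1) := by
      have : (2 : ℤ) ^ (t + 1 + 1) = 2 * 2 ^ (t + 1) := by ring
      rw [this] at hi
      exact_mod_cast hi
    cases i with
    | zero => rw [pow_zero] at hi'; omega
    | succ j =>
      rw [pow_succ 2 j] at hi'
      refine ⟨j, ?_, by omega⟩
      have : 2 ^ j ≤ 2 ^ (t + 1) := by omega
      exact (Nat.pow_le_pow_iff_right (by norm_num)).1 this
  refine ⟨main, ?_⟩
  rintro i h2 hit ⟨ha, hb⟩
  have hpos : 0 < 2 ^ (i - 1) := Nat.pow_pos (by norm_num)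
  obtain ⟨j, hj, he⟩ := main (by omega)
  rw [he] at ha hb
  have h1 : 2 ^ j < 2 ^ i := by omega
  have h3 : (2 : ℕ) ^ j ≤ 2 ^ (t + 1) := Nat.pow_le_pow_right (by norm_num) hj
  have h4 : 2 ^ (i - 1) < 2 ^ j := by omega
  have h5 := (Nat.pow_lt_pow_iff_right (by norm_num : 1 < 2)).1 h1
  have h6 := (Nat.pow_lt_pow_iff_right (by norm_num : 1 < 2)).1 h4
  omega
end
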